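/- arXiv:1603.04416 — 2 statements merged into one kernel-verified Lean document; each statement's English description precedes it below -/
import Mathlib

section
/- An idealised conformity measure A is F-optimal if and only if it is E-optimal, if and only if A is a refinement of some MCP idealised conformity measure; that is, O(F) = O(E) = R(MCP). -/
noncomputable section Conformal

open Finset

variable {X Y : Type*} [Fintype X] [Fintype Y] [DecidableEq Y]

/-- The p-value `p_A(x,y,τ) = Q{z : A z < A (x,y)} + τ·Q{z : A z = A (x,y)}`. -/
def pValue (Q A : X × Y → ℝ) (x : X) (y : Y) (τ : ℝ) : ℝ :=
  (∑ z : X × Y, if A z < A (x, y) then Q z else 0)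
    + τ * ∑ z : X × Y, if A z = A (x, y) then Q z else 0

/-- The prediction set `Γ_A^ε(x,τ) = {y : p_A(x,y,τ) > ε}`. -/
def predSet (Q A : X × Y → ℝ) (ε : ℝ) (x : X) (τ : ℝ) : Finset Y :=
  Finset.univ.filter fun y => ε < pValue Q A x y τ

/-- The marginal `Q_X` of `Q` on the object space. -/
def margX (Q : X × Y → ℝ) (x : X) : ℝ := ∑ y, Q (x, y)

/-- The marginal `Q_Y` of `Q` on the label space. -/
def margY (Q : X × Y → ℝ) (y : Y) : ℝ := ∑ x, Q (x, y)

/-- The conditional probability `Q(y|x)`; as a function of `z = (x,y)` this is the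
CP idealised conformity measure. -/
def condQ (Q : X × Y → ℝ) (z : X × Y) : ℝ := Q z / margX Q z.1

/-- Expectation `E_{x,τ}` with `x ~ Q_X` and `τ` uniform on `[0,1]`, independent. -/
def expXT (Q : X × Y → ℝ) (g : X → ℝ → ℝ) : ℝ :=
  ∑ x, margX Q x * ∫ τ in (0:ℝ)..1, g x τ

/-- Expectation `E_{(x,y),τ}` with `(x,y) ~ Q` and `τ` uniform on `[0,1]`, independent. -/
def expZT (Q : X × Y → ℝ) (g : X × Y → ℝ → ℝ) : ℝ :=
  ∑ z, Q z * ∫ τ in (0:ℝ)..1, g z τ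

open Classical in
/-- Probability `Prob_{x,τ}` with `x ~ Q_X` and `τ` uniform on `[0,1]`, independent. -/
def probXT (Q : X × Y → ℝ) (P : X → ℝ → Prop) : ℝ :=
  expXT Q fun x τ => if P x τ then 1 else 0

open Classical in
/-- Probability `Prob_{(x,y),τ}` with `(x,y) ~ Q` and `τ` uniform on `[0,1]`, independent. -/
def probZT (Q : X × Y → ℝ) (P : X × Y → ℝ → Prop) : ℝ :=
  expZT Q fun z τ => if P z τ then 1 else 0

/-- `A` is a refinement of `B`. -/
def Refines (A B : X × Y → ℝ) : Prop :=
  ∀ z1 z2 : X × Y, B z1 < B z2 → A z1 < A z2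

/-- `max_{y' ≠ y} p_A(x,y',τ)`. -/
def maxOther (Q A : X × Y → ℝ) (x : X) (y : Y) (τ : ℝ) : ℝ :=
  ⨆ y' : {y' : Y // y' ≠ y}, pValue Q A x y'.1 τ

/-- The unconfidence `min_y max_{y' ≠ y} p_A(x,y',τ)`. -/
def unconf (Q A : X × Y → ℝ) (x : X) (τ : ℝ) : ℝ := ⨅ y : Y, maxOther Q A x y τ

/-- The credibility `max_y p_A(x,y,τ)`. -/
def maxPV (Q A : X × Y → ℝ) (x : X) (τ : ℝ) : ℝ := ⨆ y : Y, pValue Q A x y τ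

/-- The predictability `f(x) = max_y Q(y|x)`. -/
def predictability (Q : X × Y → ℝ) (x : X) : ℝ := ⨆ y : Y, condQ Q (x, y)

/-- `c` is a choice function: `Q(c x | x) = f(x)` for all `x`. -/
def IsChoiceFun (Q : X × Y → ℝ) (c : X → Y) : Prop :=
  ∀ x, condQ Q (x, c x) = predictability Q x

/-- The signed predictability (SP) idealised conformity measure corresponding to `c`. -/
def SPMeasure (Q : X × Y → ℝ) (c : X → Y) : X × Y → ℝ := fun z =>
  if z.2 = c z.1 then predictability Q z.1 else -predictability Q z.1

/-- The modified conditional probability (MCP) idealised conformity measure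
corresponding to `c`. -/
def MCPMeasure (Q : X × Y → ℝ) (c : X → Y) : X × Y → ℝ := fun z =>
  if z.2 = c z.1 then condQ Q z else condQ Q z - 1

/-- The modified signed predictability (MSP) idealised conformity measure
(independent of the choice function: `y = ŷ(x)` iff `Q(y|x) = f(x)` when `f(x) > 1/2`). -/
def MSPMeasure (Q : X × Y → ℝ) : X × Y → ℝ := fun z =>
  if 1 / 2 < predictability Q z.1 then
    if condQ Q z = predictability Q z.1 then predictability Q z.1
    else -predictability Q z.1
  else 0

/-- S-optimality. -/
def SOpt (Q A : X × Y → ℝ) : Prop :=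
  ∀ B : X × Y → ℝ,
    expXT Q (fun x τ => ∑ y, pValue Q A x y τ)
      ≤ expXT Q (fun x τ => ∑ y, pValue Q B x y τ)

/-- N-optimality. -/
def NOpt (Q A : X × Y → ℝ) : Prop :=
  ∀ B : X × Y → ℝ, ∀ ε ∈ Set.Ioo (0:ℝ) 1,
    expXT Q (fun x τ => ((predSet Q A ε x τ).card : ℝ))
      ≤ expXT Q (fun x τ => ((predSet Q B ε x τ).card : ℝ))

/-- OF-optimality. -/
def OFOpt (Q A : X × Y → ℝ) : Prop :=
  ∀ B : X × Y → ℝ,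
    expZT Q (fun z τ => ∑ y' ∈ Finset.univ.erase z.2, pValue Q A z.1 y' τ)
      ≤ expZT Q (fun z τ => ∑ y' ∈ Finset.univ.erase z.2, pValue Q B z.1 y' τ)

/-- OE-optimality. -/
def OEOpt (Q A : X × Y → ℝ) : Prop :=
  ∀ B : X × Y → ℝ, ∀ ε ∈ Set.Ioo (0:ℝ) 1,
    expZT Q (fun z τ => (((predSet Q A ε z.1 τ).erase z.2).card : ℝ))
      ≤ expZT Q (fun z τ => (((predSet Q B ε z.1 τ).erase z.2).card : ℝ))

/-- U-optimality. -/
def UOpt (Q A : X × Y → ℝ) : Prop :=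
  ∀ B : X × Y → ℝ,
    expXT Q (unconf Q A) < expXT Q (unconf Q B) ∨
      (expXT Q (unconf Q A) = expXT Q (unconf Q B) ∧
        expXT Q (maxPV Q A) ≤ expXT Q (maxPV Q B))

/-- M-optimality. -/
def MOpt (Q A : X × Y → ℝ) : Prop :=
  ∀ B : X × Y → ℝ, ∀ ε ∈ Set.Ioo (0:ℝ) 1,
    probXT Q (fun x τ => 1 < (predSet Q A ε x τ).card)
        < probXT Q (fun x τ => 1 < (predSet Q B ε x τ).card) ∨
      (probXT Q (fun x τ => 1 < (predSet Q A ε x τ).card)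
          = probXT Q (fun x τ => 1 < (predSet Q B ε x τ).card) ∧
        probXT Q (fun x τ => (predSet Q B ε x τ).card = 0)
          ≤ probXT Q (fun x τ => (predSet Q A ε x τ).card = 0))

/-- F-optimality. -/
def FOpt (Q A : X × Y → ℝ) : Prop :=
  ∀ B : X × Y → ℝ,
    expXT Q (fun x τ => (∑ y, pValue Q A x y τ) - maxPV Q A x τ)
        < expXT Q (fun x τ => (∑ y, pValue Q B x y τ) - maxPV Q B x τ) ∨
      (expXT Q (fun x τ => (∑ y, pValue Q A x y τ) - maxPV Q A x τ)
          = expXT Q (fun x τ => (∑ y, pValue Q B x y τ) - maxPV Q B x τ) ∧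
        expXT Q (maxPV Q A) ≤ expXT Q (maxPV Q B))

/-- E-optimality. -/
def EOpt (Q A : X × Y → ℝ) : Prop :=
  ∀ B : X × Y → ℝ, ∀ ε ∈ Set.Ioo (0:ℝ) 1,
    expXT Q (fun x τ => max (((predSet Q A ε x τ).card : ℝ) - 1) 0)
        < expXT Q (fun x τ => max (((predSet Q B ε x τ).card : ℝ) - 1) 0) ∨
      (expXT Q (fun x τ => max (((predSet Q A ε x τ).card : ℝ) - 1) 0)
          = expXT Q (fun x τ => max (((predSet Q B ε x τ).card : ℝ) - 1) 0) ∧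
        probXT Q (fun x τ => (predSet Q B ε x τ).card = 0)
          ≤ probXT Q (fun x τ => (predSet Q A ε x τ).card = 0))

/-- OU-optimality. -/
def OUOpt (Q A : X × Y → ℝ) : Prop :=
  ∀ B : X × Y → ℝ,
    expZT Q (fun z τ => maxOther Q A z.1 z.2 τ)
      ≤ expZT Q (fun z τ => maxOther Q B z.1 z.2 τ)

/-- OM-optimality. -/
def OMOpt (Q A : X × Y → ℝ) : Prop :=
  ∀ B : X × Y → ℝ, ∀ ε ∈ Set.Ioo (0:ℝ) 1,
    probZT Q (fun z τ => ((predSet Q A ε z.1 τ).erase z.2).Nonempty)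
      ≤ probZT Q (fun z τ => ((predSet Q B ε z.1 τ).erase z.2).Nonempty)

end Conformal

open MeasureTheory

section Conformity

variable {X Y : Type*} [Fintype Y] {Q A : X × Y → ℝ}

/-- `c x` is a most conforming label for each object `x`. -/
def HasTopLabels (A : X × Y → ℝ) (c : X → Y) : Prop := ∀ x y, A (x, y) ≤ A (x, c x)

lemma exists_hasTopLabels [Nonempty Y] (Q A : X × Y → ℝ) :
    ∃ c : X → Y, HasTopLabels A c ∧
      ∀ x y, A (x, y) = A (x, c x) → Q (x, y) ≤ Q (x, c x) := by
  have : ∀ x, ∃ y, (∀ y', A (x, y') ≤ A (x, y)) ∧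
      ∀ y', A (x, y') = A (x, y) → Q (x, y') ≤ Q (x, y) := by
    intro x
    obtain ⟨y₀, -, h₀⟩ := Finset.exists_max_image Finset.univ (fun y => A (x, y))
      Finset.univ_nonempty
    obtain ⟨y, hy, h⟩ := Finset.exists_max_image
      (Finset.univ.filter fun y => A (x, y) = A (x, y₀)) (fun y => Q (x, y)) ⟨y₀, by simp⟩
    simp only [Finset.mem_filter, Finset.mem_univ, true_and, true_implies] at hy h h₀
    exact ⟨y, fun y' => (h₀ y').trans_eq hy.symm, fun y' hy' => h y' (hy'.trans hy)⟩
  choose c hc using this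
  exact ⟨c, fun x => (hc x).1, fun x => (hc x).2⟩

lemma IsChoiceFun.le (hQX : ∀ x, 0 < margX Q x) {c : X → Y} (hc : IsChoiceFun Q c)
    (x : X) (y : Y) : Q (x, y) ≤ Q (x, c x) := by
  have h : condQ Q (x, y) ≤ condQ Q (x, c x) := by
    rw [hc x]
    exact le_ciSup (f := fun y => condQ Q (x, y)) (Set.finite_range _).bddAbove y
  exact (div_le_div_iff_of_pos_right (hQX x)).mp h

lemma isChoiceFun_of_le (hQX : ∀ x, 0 < margX Q x) {c : X → Y}
    (hc : ∀ x y, Q (x, y) ≤ Q (x, c x)) : IsChoiceFun Q c := by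
  intro x
  have : Nonempty Y := ⟨c x⟩
  refine le_antisymm (le_ciSup (f := fun y => condQ Q (x, y)) (Set.finite_range _).bddAbove (c x))
    (ciSup_le fun y => ?_)
  exact (div_le_div_iff_of_pos_right (hQX x)).mpr (hc x y)

lemma pos_of_forall_le (hQ0 : ∀ z, 0 ≤ Q z) (hQX : ∀ x, 0 < margX Q x) {c : X → Y}
    (hc : ∀ x y, Q (x, y) ≤ Q (x, c x)) (x : X) : 0 < Q (x, c x) := by
  by_contra! h
  have : margX Q x = 0 :=
    Finset.sum_eq_zero fun y _ => le_antisymm ((hc x y).trans h) (hQ0 _)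
  exact (hQX x).ne' this

lemma condQ_lt_one (hQ0 : ∀ z, 0 ≤ Q z) (hQX : ∀ x, 0 < margX Q x) {x : X} {y y' : Y}
    (hne : y ≠ y') (hpos : 0 < Q (x, y')) : condQ Q (x, y) < 1 := by
  classical
  rw [condQ, div_lt_one (hQX x), margX, ← Finset.add_sum_erase _ _ (Finset.mem_univ y)]
  have := Finset.single_le_sum (f := fun y => Q (x, y)) (fun y _ => hQ0 _)
    (Finset.mem_erase.mpr ⟨hne.symm, Finset.mem_univ y'⟩)
  linarith

lemma MCPMeasure_neg [DecidableEq Y] (hQ0 : ∀ z, 0 ≤ Q z) (hQX : ∀ x, 0 < margX Q x) {c : X → Y}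
    (hc : ∀ x y, Q (x, y) ≤ Q (x, c x)) {z : X × Y} (hz : z.2 ≠ c z.1) :
    MCPMeasure Q c z < 0 := by
  rw [MCPMeasure, if_neg hz]
  linarith [condQ_lt_one hQ0 hQX hz (pos_of_forall_le hQ0 hQX hc z.1)]

lemma MCPMeasure_pos [DecidableEq Y] (hQ0 : ∀ z, 0 ≤ Q z) (hQX : ∀ x, 0 < margX Q x) {c : X → Y}
    (hc : ∀ x y, Q (x, y) ≤ Q (x, c x)) {z : X × Y} (hz : z.2 = c z.1) :
    0 < MCPMeasure Q c z := by
  obtain ⟨x, y⟩ := z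
  obtain rfl : y = c x := hz
  rw [MCPMeasure, if_pos rfl]
  exact div_pos (pos_of_forall_le hQ0 hQX hc x) (hQX x)

lemma hasTopLabels_of_refines [DecidableEq Y] (hQ0 : ∀ z, 0 ≤ Q z) (hQX : ∀ x, 0 < margX Q x) {c : X → Y}
    (hc : ∀ x y, Q (x, y) ≤ Q (x, c x)) (hA : Refines A (MCPMeasure Q c)) :
    HasTopLabels A c := by
  intro x y
  by_cases h : y = c x
  · rw [h]
  · exact (hA (x, y) (x, c x) ((MCPMeasure_neg hQ0 hQX hc h).trans
      (MCPMeasure_pos (z := (x, c x)) hQ0 hQX hc rfl))).le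

variable [Fintype X]

/-- The indicator of `A w < A z`, with ties counted as one half. -/
noncomputable def precKernel {ι : Type*} (A : ι → ℝ) (w z : ι) : ℝ :=
  (if A w < A z then 1 else 0) + (1 / 2) * (if A w = A z then 1 else 0)

lemma precKernel_add_swap {ι : Type*} (A : ι → ℝ) (w z : ι) :
    precKernel A w z + precKernel A z w = 1 := by
  unfold precKernel
  rcases lt_trichotomy (A w) (A z) with h | h | h
  · simp [h, h.not_gt, h.ne, h.ne']
  · norm_num [h]
  · simp [h, h.not_gt, h.ne, h.ne']

lemma precKernel_nonneg {ι : Type*} (A : ι → ℝ) (w z : ι) : 0 ≤ precKernel A w z := by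
  unfold precKernel
  positivity

lemma precKernel_pos {ι : Type*} {A : ι → ℝ} {w z : ι} (h : A w ≤ A z) :
    0 < precKernel A w z := by
  unfold precKernel
  rcases h.lt_or_eq with h | h
  · simp [h, h.ne]
  · simp [h]

lemma precKernel_eq_zero {ι : Type*} {A : ι → ℝ} {w z : ι} (h : A z < A w) :
    precKernel A w z = 0 := by
  simp [precKernel, h.not_gt, h.ne']

lemma precKernel_anti_left {ι : Type*} {A : ι → ℝ} {u v : ι} (h : A v ≤ A u) (z : ι) :
    precKernel A u z ≤ precKernel A v z := by
  unfold precKernel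
  rcases h.lt_or_eq with h | h
  · rcases lt_trichotomy (A u) (A z) with h' | h' | h'
    · simp [h', h.trans h', h'.ne, (h.trans h').ne]
    · rw [← h']
      norm_num [h, h.ne]
    · rw [if_neg h'.not_gt, if_neg h'.ne']
      simp only [mul_zero, add_zero]
      positivity
  · rw [h]

/-- The mean of the p-value of `z` over `τ`. -/
noncomputable def meanPValue (Q A : X × Y → ℝ) (z : X × Y) : ℝ :=
  ∫ τ in (0:ℝ)..1, pValue Q A z.1 z.2 τ

/-- The probability over `τ` that the label of `z` belongs to the prediction set at level `ε`. -/
noncomputable def coverProb (Q A : X × Y → ℝ) (ε : ℝ) (z : X × Y) : ℝ :=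
  ∫ τ in (0:ℝ)..1, if ε < pValue Q A z.1 z.2 τ then (1:ℝ) else 0

/-- The total of `f` over the labels outside the graph of `c`, averaged over the objects. -/
noncomputable def offCost [DecidableEq Y] (Q : X × Y → ℝ) (c : X → Y) (f : X × Y → ℝ) : ℝ :=
  ∑ z : X × Y, margX Q z.1 * (if z.2 = c z.1 then 0 else f z)

/-- The average of `f` over the graph of `c`. -/
noncomputable def onCost (Q : X × Y → ℝ) (c : X → Y) (f : X × Y → ℝ) : ℝ :=
  ∑ x, margX Q x * f (x, c x)

lemma continuous_pValue (Q A : X × Y → ℝ) (x : X) (y : Y) : Continuous (pValue Q A x y) := by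
  unfold pValue
  fun_prop

lemma meanPValue_eq (Q A : X × Y → ℝ) (z : X × Y) :
    meanPValue Q A z = ∑ w, Q w * precKernel A w z := by
  unfold meanPValue pValue
  rw [intervalIntegral.integral_add (by simp) (by
    apply Continuous.intervalIntegrable; fun_prop)]
  rw [intervalIntegral.integral_const, intervalIntegral.integral_mul_const, integral_id,
    smul_eq_mul, Finset.mul_sum, Finset.mul_sum, ← Finset.sum_add_distrib]
  simp only [precKernel]
  apply Finset.sum_congr rfl
  intro w _
  split_ifs <;> ring

lemma pValue_le_of_lt (hQ0 : ∀ z, 0 ≤ Q z) {z w : X × Y} (h : A z < A w) {s t : ℝ}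
    (hs : s ≤ 1) (ht : 0 ≤ t) : pValue Q A z.1 z.2 s ≤ pValue Q A w.1 w.2 t := by
  have h1 : pValue Q A z.1 z.2 s ≤ ∑ v, if A v < A w then Q v else 0 := by
    have h2 : 0 ≤ ∑ v : X × Y, if A v = A z then Q v else 0 :=
      Finset.sum_nonneg fun v _ => by split_ifs <;> simp [hQ0]
    calc pValue Q A z.1 z.2 s
        ≤ (∑ v, if A v < A z then Q v else 0) + 1 * ∑ v, if A v = A z then Q v else 0 := by
          unfold pValue
          gcongr
      _ = ∑ v, ((if A v < A z then Q v else 0) + if A v = A z then Q v else 0) := by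
          rw [one_mul, Finset.sum_add_distrib]
      _ ≤ _ := by
          apply Finset.sum_le_sum
          intro v _
          have := hQ0 v
          split_ifs <;> linarith
  have h3 : 0 ≤ t * ∑ v : X × Y, if A v = A w then Q v else 0 :=
    mul_nonneg ht (Finset.sum_nonneg fun v _ => by split_ifs <;> simp [hQ0])
  unfold pValue at h1 ⊢
  linarith

lemma pValue_le_of_le (hQ0 : ∀ z, 0 ≤ Q z) {x x' : X} {y y' : Y} (h : A (x, y) ≤ A (x', y'))
    {t : ℝ} (ht : t ∈ Set.Icc (0:ℝ) 1) : pValue Q A x y t ≤ pValue Q A x' y' t := by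
  rcases h.lt_or_eq with h | h
  · exact pValue_le_of_lt (z := (x, y)) (w := (x', y')) hQ0 h ht.2 ht.1
  · simp [pValue, h]

lemma monotone_pValue (hQ0 : ∀ z, 0 ≤ Q z) (x : X) (y : Y) : Monotone (pValue Q A x y) := by
  intro s t hst
  unfold pValue
  have h2 : 0 ≤ ∑ v : X × Y, if A v = A (x, y) then Q v else 0 :=
    Finset.sum_nonneg fun v _ => by split_ifs <;> simp [hQ0]
  gcongr

lemma intervalIntegrable_cover (hQ0 : ∀ z, 0 ≤ Q z) (ε : ℝ) (x : X) (y : Y) :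
    IntervalIntegrable (fun τ => if ε < pValue Q A x y τ then (1:ℝ) else 0) volume 0 1 := by
  apply Monotone.intervalIntegrable
  intro s t hst
  have := monotone_pValue (A := A) hQ0 x y hst
  dsimp only
  split_ifs <;> linarith

lemma sum_sub_eq_offCost [DecidableEq Y] (c : X → Y) (f : X × Y → ℝ) :
    ∑ x, margX Q x * ((∑ y, f (x, y)) - f (x, c x)) = offCost Q c f := by
  rw [offCost, Fintype.sum_prod_type]
  refine Finset.sum_congr rfl fun x _ => ?_
  dsimp only
  rw [← Finset.mul_sum]
  congr 1
  rw [← Finset.add_sum_erase _ (fun y => f (x, y)) (Finset.mem_univ (c x)),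
    ← Finset.add_sum_erase _ (fun y => if y = c x then 0 else f (x, y)) (Finset.mem_univ (c x))]
  simp only [if_true, add_sub_cancel_left, zero_add]
  refine Finset.sum_congr rfl fun y hy => ?_
  simp [Finset.ne_of_mem_erase hy]

lemma maxPV_eq (hQ0 : ∀ z, 0 ≤ Q z) {c : X → Y} (hc : HasTopLabels A c) (x : X) {t : ℝ}
    (ht : t ∈ Set.Icc (0:ℝ) 1) : maxPV Q A x t = pValue Q A x (c x) t := by
  have : Nonempty Y := ⟨c x⟩
  exact le_antisymm (ciSup_le fun y => pValue_le_of_le hQ0 (hc x y) ht)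
    (le_ciSup (f := fun y => pValue Q A x y t) (Set.finite_range _).bddAbove (c x))

lemma expXT_maxPV (hQ0 : ∀ z, 0 ≤ Q z) {c : X → Y} (hc : HasTopLabels A c) :
    expXT Q (maxPV Q A) = onCost Q c (meanPValue Q A) := by
  refine Finset.sum_congr rfl fun x _ => ?_
  congr 1
  refine intervalIntegral.integral_congr fun t ht => ?_
  rw [Set.uIcc_of_le zero_le_one] at ht
  exact maxPV_eq hQ0 hc x ht

lemma expXT_fuzziness [DecidableEq Y] (hQ0 : ∀ z, 0 ≤ Q z) {c : X → Y} (hc : HasTopLabels A c) :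
    expXT Q (fun x τ => (∑ y, pValue Q A x y τ) - maxPV Q A x τ)
      = offCost Q c (meanPValue Q A) := by
  rw [← sum_sub_eq_offCost]
  refine Finset.sum_congr rfl fun x _ => ?_
  congr 1
  have hi : ∀ y, IntervalIntegrable (pValue Q A x y) volume 0 1 := fun y =>
    (continuous_pValue Q A x y).intervalIntegrable _ _
  have hs : IntervalIntegrable (fun τ => ∑ y, pValue Q A x y τ) volume 0 1 :=
    (continuous_finsetSum _ fun y _ => continuous_pValue Q A x y).intervalIntegrable _ _
  rw [intervalIntegral.integral_congr
    (g := fun τ => (∑ y, pValue Q A x y τ) - pValue Q A x (c x) τ),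
    intervalIntegral.integral_sub hs (hi _), intervalIntegral.integral_finsetSum fun y _ => hi y]
  · rfl
  · intro t ht
    rw [Set.uIcc_of_le zero_le_one] at ht
    simp only [maxPV_eq hQ0 hc x ht]

lemma predSet_eq_empty_iff (hQ0 : ∀ z, 0 ≤ Q z) {c : X → Y} (hc : HasTopLabels A c) (ε : ℝ) (x : X)
    {t : ℝ} (ht : t ∈ Set.Icc (0:ℝ) 1) :
    predSet Q A ε x t = ∅ ↔ ¬ ε < pValue Q A x (c x) t := by
  simp only [predSet, Finset.filter_eq_empty_iff, Finset.mem_univ, true_implies]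
  exact ⟨fun h => @h (c x), fun h y hy => h (hy.trans_le (pValue_le_of_le hQ0 (hc x y) ht))⟩

lemma expXT_excess [DecidableEq Y] (hQ0 : ∀ z, 0 ≤ Q z) {c : X → Y} (hc : HasTopLabels A c) (ε : ℝ) :
    expXT Q (fun x τ => max (((predSet Q A ε x τ).card : ℝ) - 1) 0)
      = offCost Q c (coverProb Q A ε) := by
  rw [← sum_sub_eq_offCost]
  refine Finset.sum_congr rfl fun x _ => ?_
  congr 1
  have hi := intervalIntegrable_cover (A := A) hQ0 ε x
  have hs : IntervalIntegrable (fun τ => ∑ y, if ε < pValue Q A x y τ then (1:ℝ) else 0)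
      volume 0 1 := by
    simpa [Finset.sum_fn] using IntervalIntegrable.sum Finset.univ fun y _ => hi y
  rw [intervalIntegral.integral_congr
    (g := fun τ => (∑ y, if ε < pValue Q A x y τ then (1:ℝ) else 0)
      - if ε < pValue Q A x (c x) τ then (1:ℝ) else 0),
    intervalIntegral.integral_sub hs (hi _), intervalIntegral.integral_finsetSum fun y _ => hi y]
  · rfl
  · intro t ht
    rw [Set.uIcc_of_le zero_le_one] at ht
    have hcard : ((predSet Q A ε x t).card : ℝ)
        = ∑ y, if ε < pValue Q A x y t then (1:ℝ) else 0 := by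
      simp [predSet]
    have he := predSet_eq_empty_iff hQ0 hc ε x ht
    dsimp only
    rw [← hcard]
    by_cases h : ε < pValue Q A x (c x) t
    · have h1 : 1 ≤ (predSet Q A ε x t).card := by
        rw [Nat.one_le_iff_ne_zero, Ne, Finset.card_eq_zero, he]
        exact not_not.mpr h
      have h1' : (1:ℝ) ≤ (predSet Q A ε x t).card := by exact_mod_cast h1
      rw [if_pos h, max_eq_left (by linarith)]
    · rw [if_neg h, he.mpr h]
      simp

lemma probXT_empty (hQ0 : ∀ z, 0 ≤ Q z) {c : X → Y} (hc : HasTopLabels A c) (ε : ℝ) :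
    probXT Q (fun x τ => (predSet Q A ε x τ).card = 0)
      = ∑ x, margX Q x - onCost Q c (coverProb Q A ε) := by
  rw [onCost, ← Finset.sum_sub_distrib]
  refine Finset.sum_congr rfl fun x _ => ?_
  rw [← mul_one_sub]
  congr 1
  rw [intervalIntegral.integral_congr
    (g := fun τ => 1 - if ε < pValue Q A x (c x) τ then (1:ℝ) else 0),
    intervalIntegral.integral_sub (by simp) (intervalIntegrable_cover hQ0 ε x (c x))]
  · simp [coverProb]
  · intro t ht
    rw [Set.uIcc_of_le zero_le_one] at ht
    have he := predSet_eq_empty_iff hQ0 hc ε x ht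
    by_cases h : ε < pValue Q A x (c x) t
    · simp [he, h]
    · simp [he.mpr h, h]

lemma integral_indicator_lt (ε L R : ℝ) :
    ∫ u in L..R, (if ε < u then (1:ℝ) else 0) = max R ε - max L ε := by
  have hi : ∀ a b : ℝ, IntervalIntegrable (fun u => if ε < u then (1:ℝ) else 0) volume a b := by
    intro a b
    apply Monotone.intervalIntegrable
    intro s t hst
    dsimp only
    split_ifs <;> linarith
  have key : ∀ r : ℝ, ∫ u in ε..r, (if ε < u then (1:ℝ) else 0) = max r ε - ε := by
    intro r
    rcases le_total ε r with h | h
    · rw [max_eq_left h, intervalIntegral.integral_congr_uIoo (g := fun _ => (1:ℝ))]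
      · simp
      · intro u hu
        rw [Set.uIoo_of_le h] at hu
        simp [hu.1]
    · rw [max_eq_right h, intervalIntegral.integral_congr (g := fun _ => (0:ℝ))]
      · simp
      · intro u hu
        rw [Set.uIcc_of_ge h] at hu
        simp [hu.2.not_gt]
  rw [← intervalIntegral.integral_interval_sub_left (hi ε R) (hi ε L), key, key]
  ring

lemma mul_integral_threshold {ε L D : ℝ} :
    D * ∫ τ in (0:ℝ)..1, (if ε < L + τ * D then (1:ℝ) else 0) = max (L + D) ε - max L ε := by
  have h := intervalIntegral.mul_integral_comp_add_mul
    (f := fun u => if ε < u then (1:ℝ) else 0) (a := 0) (b := 1) D L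
  simp only [mul_zero, add_zero, mul_one, integral_indicator_lt] at h
  simpa only [mul_comm] using h

lemma sum_telescope {ι : Type*} [Fintype ι] (Q A : ι → ℝ) (g : ℝ → ℝ) (s : Finset ℝ) :
    ∑ a ∈ s, (g (∑ z, if A z ∈ s ∧ A z ≤ a then Q z else 0)
        - g (∑ z, if A z ∈ s ∧ A z < a then Q z else 0))
      = g (∑ z, if A z ∈ s then Q z else 0) - g 0 := by
  induction s using Finset.induction_on_max with
  | empty => simp
  | insert a s ha ih =>
    have has : a ∉ s := fun h => (ha a h).false
    rw [Finset.sum_insert has]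
    have h1 : ∀ z, (A z ∈ insert a s ∧ A z ≤ a) ↔ A z ∈ insert a s := by
      intro z
      simp only [Finset.mem_insert, and_iff_left_iff_imp]
      rintro (h | h)
      · exact h.le
      · exact (ha _ h).le
    have h2 : ∀ z, (A z ∈ insert a s ∧ A z < a) ↔ A z ∈ s := by
      intro z
      simp only [Finset.mem_insert]
      constructor
      · rintro ⟨h | h, h'⟩
        · exact absurd h h'.ne
        · exact h
      · exact fun h => ⟨Or.inr h, ha _ h⟩
    have h3 : ∀ b ∈ s, ∀ z, (A z ∈ insert a s ∧ A z ≤ b) ↔ (A z ∈ s ∧ A z ≤ b) := by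
      intro b hb z
      have := ha b hb
      simp only [Finset.mem_insert]
      grind
    have h4 : ∀ b ∈ s, ∀ z, (A z ∈ insert a s ∧ A z < b) ↔ (A z ∈ s ∧ A z < b) := by
      intro b hb z
      have := ha b hb
      simp only [Finset.mem_insert]
      grind
    rw [Finset.sum_congr (g := fun b => g (∑ z, if A z ∈ s ∧ A z ≤ b then Q z else 0)
        - g (∑ z, if A z ∈ s ∧ A z < b then Q z else 0)) rfl
      (fun b hb => by simp only [h3 b hb, h4 b hb]), ih]
    simp only [h1, h2]
    ring

/-- Validity: the p-value of a random example is uniformly distributed. -/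
lemma sum_mul_coverProb (hQ1 : ∑ z, Q z = 1) {ε : ℝ} (hε : ε ∈ Set.Ioo (0:ℝ) 1) :
    ∑ z, Q z * coverProb Q A ε z = 1 - ε := by
  have key := sum_telescope Q A (fun t => max t ε) (Finset.univ.image A)
  simp only [Finset.mem_image_of_mem A (Finset.mem_univ _), true_and, if_true, hQ1,
    max_eq_left hε.2.le, max_eq_right hε.1.le] at key
  rw [← key, ← Finset.sum_fiberwise_of_maps_to (g := A) (t := Finset.univ.image A)
    (fun z _ => Finset.mem_image_of_mem A (Finset.mem_univ z))]
  refine Finset.sum_congr rfl fun a _ => ?_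
  have hle : (∑ z, if A z ≤ a then Q z else 0)
      = (∑ z, if A z < a then Q z else 0) + ∑ z, if A z = a then Q z else 0 := by
    rw [← Finset.sum_add_distrib]
    refine Finset.sum_congr rfl fun z _ => ?_
    rcases lt_trichotomy (A z) a with h | h | h
    · simp [h, h.le, h.ne]
    · simp [h]
    · simp [h.not_ge, h.not_gt, h.ne']
  rw [hle, ← mul_integral_threshold, ← Finset.sum_filter (fun z => A z = a) Q, Finset.sum_mul,
    Finset.sum_filter (fun z => A z = a) Q]
  refine Finset.sum_congr rfl fun z hz => ?_
  rw [Finset.mem_filter] at hz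
  simp only [coverProb, pValue, Prod.mk.eta, hz.2]

lemma coverProb_mem (hQ0 : ∀ z, 0 ≤ Q z) (ε : ℝ) (z : X × Y) :
    coverProb Q A ε z ∈ Set.Icc (0:ℝ) 1 := by
  constructor
  · exact intervalIntegral.integral_nonneg zero_le_one fun t _ => by split_ifs <;> norm_num
  · calc coverProb Q A ε z ≤ ∫ τ in (0:ℝ)..1, (1:ℝ) :=
        intervalIntegral.integral_mono_on zero_le_one (intervalIntegrable_cover hQ0 ε z.1 z.2)
          (by simp) fun t _ => by split_ifs <;> norm_num
      _ = 1 := by simp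

lemma coverProb_mono (hQ0 : ∀ z, 0 ≤ Q z) (ε : ℝ) {z w : X × Y} (h : A z ≤ A w) :
    coverProb Q A ε z ≤ coverProb Q A ε w := by
  refine intervalIntegral.integral_mono_on zero_le_one (intervalIntegrable_cover hQ0 ε z.1 z.2)
    (intervalIntegrable_cover hQ0 ε w.1 w.2) fun t ht => ?_
  have := pValue_le_of_le (x := z.1) (y := z.2) (x' := w.1) (y' := w.2) hQ0 h ht
  split_ifs <;> linarith

lemma coverProb_antitone (hQ0 : ∀ z, 0 ≤ Q z) (z : X × Y) :
    Antitone fun ε => coverProb Q A ε z := by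
  intro ε δ h
  refine intervalIntegral.integral_mono_on zero_le_one (intervalIntegrable_cover hQ0 δ z.1 z.2)
    (intervalIntegrable_cover hQ0 ε z.1 z.2) fun t ht => ?_
  split_ifs <;> linarith

lemma coverProb_eq_zero {ε : ℝ} {z : X × Y}
    (h : ∀ t ∈ Set.Icc (0:ℝ) 1, pValue Q A z.1 z.2 t ≤ ε) : coverProb Q A ε z = 0 := by
  rw [coverProb, intervalIntegral.integral_congr (g := fun _ => (0:ℝ))]
  · simp
  · intro t ht
    rw [Set.uIcc_of_le zero_le_one] at ht
    simp [h t ht]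

lemma coverProb_eq_one_of_lt (hQ0 : ∀ z, 0 ≤ Q z) {ε : ℝ} {z w : X × Y} (h : A z < A w)
    (hz : 0 < coverProb Q A ε z) : coverProb Q A ε w = 1 := by
  have : ∃ s ∈ Set.Icc (0:ℝ) 1, ε < pValue Q A z.1 z.2 s := by
    by_contra! hcon
    exact hz.ne' (coverProb_eq_zero hcon)
  obtain ⟨s, hs, hlt⟩ := this
  rw [coverProb, intervalIntegral.integral_congr (g := fun _ => (1:ℝ))]
  · simp
  · intro t ht
    rw [Set.uIcc_of_le zero_le_one] at ht
    simp [hlt.trans_le (pValue_le_of_lt hQ0 h hs.2 ht.1)]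

lemma pValue_mem (hQ0 : ∀ z, 0 ≤ Q z) (hQ1 : ∑ z, Q z = 1) (x : X) (y : Y) {t : ℝ}
    (ht : t ∈ Set.Icc (0:ℝ) 1) : pValue Q A x y t ∈ Set.Icc (0:ℝ) 1 := by
  have hL : 0 ≤ ∑ v : X × Y, if A v < A (x, y) then Q v else 0 :=
    Finset.sum_nonneg fun v _ => by split_ifs <;> simp [hQ0]
  have hD : 0 ≤ ∑ v : X × Y, if A v = A (x, y) then Q v else 0 :=
    Finset.sum_nonneg fun v _ => by split_ifs <;> simp [hQ0]
  have hLD : (∑ v : X × Y, if A v < A (x, y) then Q v else 0)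
      + (∑ v : X × Y, if A v = A (x, y) then Q v else 0) ≤ 1 := by
    rw [← hQ1, ← Finset.sum_add_distrib]
    refine Finset.sum_le_sum fun v _ => ?_
    have := hQ0 v
    split_ifs <;> linarith
  have := mul_nonneg ht.1 hD
  have := mul_le_of_le_one_left hD ht.2
  unfold pValue
  constructor <;> linarith

lemma integral_coverProb (hQ0 : ∀ z, 0 ≤ Q z) (hQ1 : ∑ z, Q z = 1) (z : X × Y) :
    ∫ ε in (0:ℝ)..1, coverProb Q A ε z = meanPValue Q A z := by
  unfold coverProb meanPValue
  have hswap : ∫ ε in (0:ℝ)..1, ∫ τ in (0:ℝ)..1, (if ε < pValue Q A z.1 z.2 τ then (1:ℝ) else 0)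
      = ∫ τ in (0:ℝ)..1, ∫ ε in (0:ℝ)..1, (if ε < pValue Q A z.1 z.2 τ then (1:ℝ) else 0) := by
    simp only [intervalIntegral.integral_of_le zero_le_one]
    apply integral_integral_swap
    have hmeas : MeasurableSet {q : ℝ × ℝ | q.1 < pValue Q A z.1 z.2 q.2} :=
      measurableSet_lt measurable_fst
        ((continuous_pValue Q A z.1 z.2).measurable.comp measurable_snd)
    refine Integrable.of_bound (C := 1)
      (Measurable.ite hmeas measurable_const measurable_const).aestronglyMeasurable ?_
    refine Filter.Eventually.of_forall fun q => ?_
    simp only [Function.uncurry]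
    split_ifs <;> simp
  rw [hswap]
  refine intervalIntegral.integral_congr fun t ht => ?_
  rw [Set.uIcc_of_le zero_le_one] at ht
  have hp := pValue_mem (A := A) hQ0 hQ1 z.1 z.2 ht
  have h := intervalIntegral.integral_comp_neg (a := 0) (b := 1)
    (fun u => if - pValue Q A z.1 z.2 t < u then (1:ℝ) else 0)
  simp only [neg_lt_neg_iff, integral_indicator_lt, neg_zero] at h
  rw [max_eq_left (by linarith [hp.1]), max_eq_right (by linarith [hp.2])] at h
  simpa using h

/-- Integration of a lexicographic comparison. -/
lemma integral_lex {f₁ g₁ f₂ g₂ : ℝ → ℝ} (hf₁ : IntervalIntegrable f₁ volume 0 1)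
    (hg₁ : IntervalIntegrable g₁ volume 0 1) (hf₂ : IntervalIntegrable f₂ volume 0 1)
    (hg₂ : IntervalIntegrable g₂ volume 0 1)
    (h : ∀ ε ∈ Set.Ioo (0:ℝ) 1, f₁ ε < g₁ ε ∨ (f₁ ε = g₁ ε ∧ f₂ ε ≤ g₂ ε)) :
    (∫ ε in (0:ℝ)..1, f₁ ε) < (∫ ε in (0:ℝ)..1, g₁ ε) ∨
      ((∫ ε in (0:ℝ)..1, f₁ ε) = (∫ ε in (0:ℝ)..1, g₁ ε) ∧
        (∫ ε in (0:ℝ)..1, f₂ ε) ≤ (∫ ε in (0:ℝ)..1, g₂ ε)) := by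
  simp only [intervalIntegral.integral_of_le zero_le_one, integral_Ioc_eq_integral_Ioo]
  rw [intervalIntegrable_iff_integrableOn_Ioo_of_le zero_le_one] at hf₁ hg₁ hf₂ hg₂
  have hle : f₁ ≤ᵐ[volume.restrict (Set.Ioo (0:ℝ) 1)] g₁ := by
    filter_upwards [ae_restrict_mem measurableSet_Ioo] with ε hε
    rcases h ε hε with h | h
    · exact h.le
    · exact h.1.le
  refine (integral_mono_ae hf₁ hg₁ hle).lt_or_eq.imp_right fun heq => ⟨heq, ?_⟩
  have hae := (integral_eq_iff_of_ae_le hf₁ hg₁ hle).mp heq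
  refine integral_mono_ae hf₂ hg₂ ?_
  filter_upwards [hae, ae_restrict_mem measurableSet_Ioo] with ε h1 hε
  rcases h ε hε with h | h
  · exact absurd h1 h.ne
  · exact h.2

lemma integral_offCost [DecidableEq Y] (hQ0 : ∀ z, 0 ≤ Q z) (hQ1 : ∑ z, Q z = 1) (c : X → Y) :
    IntervalIntegrable (fun ε => offCost Q c (coverProb Q A ε)) volume 0 1 ∧
      ∫ ε in (0:ℝ)..1, offCost Q c (coverProb Q A ε) = offCost Q c (meanPValue Q A) := by
  have hi : ∀ z : X × Y, IntervalIntegrable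
      (fun ε => margX Q z.1 * (if z.2 = c z.1 then 0 else coverProb Q A ε z)) volume 0 1 := by
    intro z
    apply IntervalIntegrable.const_mul
    split_ifs
    · simp
    · exact (coverProb_antitone hQ0 z).intervalIntegrable
  unfold offCost
  constructor
  · simpa [Finset.sum_fn] using IntervalIntegrable.sum Finset.univ fun z _ => hi z
  · rw [intervalIntegral.integral_finsetSum fun z _ => hi z]
    refine Finset.sum_congr rfl fun z _ => ?_
    rw [intervalIntegral.integral_const_mul]
    congr 1
    split_ifs
    · simp
    · exact integral_coverProb hQ0 hQ1 z

lemma integral_onCost (hQ0 : ∀ z, 0 ≤ Q z) (hQ1 : ∑ z, Q z = 1) (c : X → Y) :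
    IntervalIntegrable (fun ε => onCost Q c (coverProb Q A ε)) volume 0 1 ∧
      ∫ ε in (0:ℝ)..1, onCost Q c (coverProb Q A ε) = onCost Q c (meanPValue Q A) := by
  have hi : ∀ x : X, IntervalIntegrable
      (fun ε => margX Q x * coverProb Q A ε (x, c x)) volume 0 1 := fun x =>
    (coverProb_antitone hQ0 _).intervalIntegrable.const_mul _
  unfold onCost
  constructor
  · simpa [Finset.sum_fn] using IntervalIntegrable.sum Finset.univ fun x _ => hi x
  · rw [intervalIntegral.integral_finsetSum fun x _ => hi x]
    refine Finset.sum_congr rfl fun x _ => ?_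
    rw [intervalIntegral.integral_const_mul, integral_coverProb hQ0 hQ1]

lemma EOpt.fOpt [DecidableEq Y] [Nonempty Y] (hQ0 : ∀ z, 0 ≤ Q z) (hQ1 : ∑ z, Q z = 1) (hA : EOpt Q A) :
    FOpt Q A := by
  intro B
  obtain ⟨c, hc, -⟩ := exists_hasTopLabels Q A
  obtain ⟨d, hd, -⟩ := exists_hasTopLabels Q B
  rw [expXT_fuzziness hQ0 hc, expXT_fuzziness hQ0 hd, expXT_maxPV hQ0 hc, expXT_maxPV hQ0 hd]
  obtain ⟨hi₁, h₁⟩ := integral_offCost (A := A) hQ0 hQ1 c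
  obtain ⟨hi₂, h₂⟩ := integral_offCost (A := B) hQ0 hQ1 d
  obtain ⟨hi₃, h₃⟩ := integral_onCost (A := A) hQ0 hQ1 c
  obtain ⟨hi₄, h₄⟩ := integral_onCost (A := B) hQ0 hQ1 d
  rw [← h₁, ← h₂, ← h₃, ← h₄]
  refine integral_lex hi₁ hi₂ hi₃ hi₄ fun ε hε => ?_
  have := hA B ε hε
  rw [expXT_excess hQ0 hc, expXT_excess hQ0 hd, probXT_empty hQ0 hc, probXT_empty hQ0 hd] at this
  exact this.imp_right fun h => ⟨h.1, by linarith [h.2]⟩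

/-- A Neyman–Pearson bound at one object when the excess labels are penalised. -/
lemma excess_le_mul {w φ ψ : Y → ℝ} {M l : ℝ} {c d : Y} (hl : 0 < l)
    (hc : ∀ y, w y ≤ w c) (hφc : φ c = 1)
    (hφ0 : ∀ y, y ≠ c → l * w y < M → φ y = 0) (hφ1 : ∀ y, y ≠ c → M < l * w y → φ y = 1)
    (hψ0 : ∀ y, 0 ≤ ψ y) (hψd : ∀ y, ψ y ≤ ψ d) :
    ψ d * (M * (∑ y, φ y - φ c) - l * ∑ y, w y * φ y)
      ≤ M * (∑ y, ψ y - ψ d) - l * ∑ y, w y * ψ y := by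
  have e : ∀ χ : Y → ℝ, ∀ b : Y, M * (∑ y, χ y - χ b) - l * ∑ y, w y * χ y
      = ∑ y, (M - l * w y) * χ y - M * χ b := by
    intro χ b
    rw [mul_sub, Finset.mul_sum, Finset.mul_sum, sub_right_comm, ← Finset.sum_sub_distrib]
    congr 1
    exact Finset.sum_congr rfl fun y _ => by ring
  rw [e, e, hφc]
  rcases le_or_gt M (l * w c) with h | h
  · have hterm : ∀ y, ψ d * ((M - l * w y) * φ y) ≤ (M - l * w y) * ψ y := by
      intro y
      by_cases hy : y = c
      · rw [hy, hφc]
        nlinarith [hψd c]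
      · rcases lt_trichotomy (l * w y) M with h' | h' | h'
        · rw [hφ0 y hy h']
          nlinarith [hψ0 y]
        · rw [h']
          simp
        · rw [hφ1 y hy h']
          nlinarith [hψd y]
    have := Finset.sum_le_sum fun y (_ : y ∈ Finset.univ) => hterm y
    rw [← Finset.mul_sum] at this
    linarith
  · have hlt : ∀ y, l * w y < M := fun y => (mul_le_mul_of_nonneg_left (hc y) hl.le).trans_lt h
    have h1 : ∑ y, (M - l * w y) * φ y = M - l * w c := by
      rw [Finset.sum_eq_single c (fun y _ hy => by rw [hφ0 y hy (hlt y), mul_zero]) (by simp),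
        hφc, mul_one]
    have h2 : (M - l * w d) * ψ d ≤ ∑ y, (M - l * w y) * ψ y :=
      Finset.single_le_sum (f := fun y => (M - l * w y) * ψ y)
        (fun y _ => mul_nonneg (sub_nonneg.mpr (hlt y).le) (hψ0 y)) (Finset.mem_univ d)
    rw [h1]
    have := mul_le_mul_of_nonneg_right (mul_le_mul_of_nonneg_left (hc d) hl.le) (hψ0 d)
    linarith

lemma sum_mul_eq [DecidableEq Y] (l : ℝ) (c : X → Y) (f : X × Y → ℝ) :
    offCost Q c f - l * ∑ z, Q z * f z
      = ∑ x, (margX Q x * (∑ y, f (x, y) - f (x, c x)) - l * ∑ y, Q (x, y) * f (x, y)) := by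
  rw [← sum_sub_eq_offCost, Fintype.sum_prod_type, Finset.mul_sum, Finset.sum_sub_distrib]

/-- Optimality of a threshold test that covers the whole graph of `c`. -/
lemma lex_le_of_full [DecidableEq Y] {c d : X → Y} {φ ψ : X × Y → ℝ} {l : ℝ} (hQ0 : ∀ z, 0 ≤ Q z)
    (hQX : ∀ x, 0 < margX Q x) (hc : ∀ x y, Q (x, y) ≤ Q (x, c x)) (hl : 0 < l)
    (hφc : ∀ x, φ (x, c x) = 1)
    (hφ0 : ∀ x y, y ≠ c x → l * Q (x, y) < margX Q x → φ (x, y) = 0)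
    (hφ1 : ∀ x y, y ≠ c x → margX Q x < l * Q (x, y) → φ (x, y) = 1)
    (hψ : ∀ z, ψ z ∈ Set.Icc (0:ℝ) 1) (hψd : ∀ x y, ψ (x, y) ≤ ψ (x, d x))
    (hsum : ∑ z, Q z * φ z = ∑ z, Q z * ψ z) :
    offCost Q c φ < offCost Q d ψ ∨
      (offCost Q c φ = offCost Q d ψ ∧ onCost Q c φ ≤ onCost Q d ψ) := by
  obtain ⟨V, hV⟩ : ∃ V : X → ℝ, ∀ x, V x =
    margX Q x * (∑ y, φ (x, y) - φ (x, c x)) - l * ∑ y, Q (x, y) * φ (x, y) := ⟨_, fun _ => rfl⟩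
  obtain ⟨W, hW⟩ : ∃ W : X → ℝ, ∀ x, W x =
    margX Q x * (∑ y, ψ (x, y) - ψ (x, d x)) - l * ∑ y, Q (x, y) * ψ (x, y) := ⟨_, fun _ => rfl⟩
  have hφV := sum_mul_eq (Q := Q) l c φ
  have hψW := sum_mul_eq (Q := Q) l d ψ
  simp only [← hV, ← hW] at hφV hψW
  have hVW : ∀ x, ψ (x, d x) * V x ≤ W x := fun x => by
    rw [hV, hW]
    exact excess_le_mul (ψ := fun y => ψ (x, y)) hl (hc x) (hφc x) (hφ0 x) (hφ1 x)
      (fun y => (hψ _).1) (hψd x)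
  have hVneg : ∀ x, V x < 0 := by
    intro x
    have h0 := excess_le_mul (ψ := fun y => if y = c x then (1:ℝ) else 0) (d := c x)
      hl (hc x) (hφc x) (hφ0 x) (hφ1 x)
      (fun y => by split_ifs <;> norm_num) (fun y => by rw [if_pos rfl]; split_ifs <;> norm_num)
    have := mul_pos hl (pos_of_forall_le hQ0 hQX hc x)
    simp only [if_true, one_mul, Finset.sum_ite_eq', Finset.mem_univ, sub_self, mul_zero, mul_ite,
      mul_one] at h0
    rw [hV]
    linarith
  have hVW' : ∀ x, V x ≤ W x := fun x => by nlinarith [hVW x, hVneg x, (hψ (x, d x)).2]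
  by_cases hfull : ∀ x, ψ (x, d x) = 1
  · have hle : offCost Q c φ ≤ offCost Q d ψ := by
      have := Finset.sum_le_sum fun x (_ : x ∈ Finset.univ) => hVW' x
      rw [hsum] at hφV
      linarith
    refine hle.lt_or_eq.imp_right fun h => ⟨h, ?_⟩
    simp only [onCost, hφc, hfull, le_refl]
  · left
    push Not at hfull
    obtain ⟨x, hx⟩ := hfull
    have hx1 : ψ (x, d x) < 1 := lt_of_le_of_ne (hψ _).2 hx
    have := Finset.sum_lt_sum (fun x (_ : x ∈ Finset.univ) => hVW' x)
      ⟨x, Finset.mem_univ x, by nlinarith [hVW x, hVneg x]⟩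
    rw [hsum] at hφV
    linarith

/-- Optimality of a threshold test supported by the graph of `c`. -/
lemma lex_le_of_supported [DecidableEq Y] {c d : X → Y} {φ ψ : X × Y → ℝ} {l : ℝ}
    (hQX : ∀ x, 0 < margX Q x) (hc : ∀ x y, Q (x, y) ≤ Q (x, c x)) (hl : 0 ≤ l)
    (hφ : ∀ x y, y ≠ c x → φ (x, y) = 0)
    (hφ0 : ∀ x, l * Q (x, c x) < margX Q x → φ (x, c x) = 0)
    (hφ1 : ∀ x, margX Q x < l * Q (x, c x) → φ (x, c x) = 1)
    (hψ : ∀ z, ψ z ∈ Set.Icc (0:ℝ) 1)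
    (hsum : ∑ z, Q z * φ z = ∑ z, Q z * ψ z) :
    offCost Q c φ < offCost Q d ψ ∨
      (offCost Q c φ = offCost Q d ψ ∧ onCost Q c φ ≤ onCost Q d ψ) := by
  have hoff : offCost Q c φ = 0 := by
    refine Finset.sum_eq_zero fun z _ => ?_
    split_ifs with h
    · simp
    · simp [hφ z.1 z.2 h]
  have hnn : ∀ z : X × Y, 0 ≤ margX Q z.1 * (if z.2 = d z.1 then 0 else ψ z) := by
    intro z
    have := (hψ z).1
    have := hQX z.1
    positivity
  have hle : offCost Q c φ ≤ offCost Q d ψ := hoff.trans_le (Finset.sum_nonneg fun z _ => hnn z)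
  refine hle.lt_or_eq.imp_right fun h => ⟨h, ?_⟩
  have hψ' : ∀ x y, y ≠ d x → ψ (x, y) = 0 := by
    intro x y hy
    have hz := (Finset.sum_eq_zero_iff_of_nonneg fun z _ => hnn z).mp (h.symm.trans hoff)
      (x, y) (Finset.mem_univ _)
    simpa [hy, (hQX x).ne'] using hz
  have hred : ∀ (e : X → Y) (χ : X × Y → ℝ), (∀ x y, y ≠ e x → χ (x, y) = 0) →
      onCost Q e χ - l * ∑ z, Q z * χ z = ∑ x, (margX Q x - l * Q (x, e x)) * χ (x, e x) := by
    intro e χ hχ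
    rw [Fintype.sum_prod_type, onCost, Finset.mul_sum, ← Finset.sum_sub_distrib]
    refine Finset.sum_congr rfl fun x _ => ?_
    rw [Finset.sum_eq_single (e x) (fun y _ hy => by rw [hχ x y hy, mul_zero]) (by simp)]
    ring
  have h1 := hred c φ hφ
  have h2 := hred d ψ hψ'
  have h3 : ∑ x, (margX Q x - l * Q (x, c x)) * φ (x, c x)
      ≤ ∑ x, (margX Q x - l * Q (x, d x)) * ψ (x, d x) := by
    refine Finset.sum_le_sum fun x _ => ?_
    have hψx := hψ (x, d x)
    have h4 : (margX Q x - l * Q (x, c x)) * ψ (x, d x)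
        ≤ (margX Q x - l * Q (x, d x)) * ψ (x, d x) :=
      mul_le_mul_of_nonneg_right (by linarith [mul_le_mul_of_nonneg_left (hc x (d x)) hl]) hψx.1
    refine le_trans ?_ h4
    rcases lt_trichotomy (l * Q (x, c x)) (margX Q x) with h' | h' | h'
    · rw [hφ0 x h']
      nlinarith [hψx.1]
    · rw [h']
      simp
    · rw [hφ1 x h']
      nlinarith [hψx.2]
  rw [hsum] at h1
  linarith

lemma coverProb_eq_zero_of_null [DecidableEq Y] (hQ0 : ∀ z, 0 ≤ Q z) (hQX : ∀ x, 0 < margX Q x) {c : X → Y}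
    (hc : ∀ x y, Q (x, y) ≤ Q (x, c x)) (hA : Refines A (MCPMeasure Q c)) {ε : ℝ} (hε : 0 ≤ ε)
    {z : X × Y} (hz : Q z = 0) : coverProb Q A ε z = 0 := by
  have hzc : z.2 ≠ c z.1 := by
    intro h
    have := pos_of_forall_le hQ0 hQX hc z.1
    rw [← h] at this
    exact this.ne' hz
  have hnull : ∀ w, A w ≤ A z → Q w = 0 := by
    intro w hw
    have hle : MCPMeasure Q c w ≤ MCPMeasure Q c z := not_lt.mp fun h => (hA z w h).not_ge hw
    have hneg := MCPMeasure_neg hQ0 hQX hc hzc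
    by_cases hwc : w.2 = c w.1
    · exact absurd (MCPMeasure_pos hQ0 hQX hc hwc) (by linarith)
    · rw [MCPMeasure, MCPMeasure, if_neg hwc, if_neg hzc, condQ, condQ, hz, zero_div,
        sub_le_sub_iff_right, div_le_iff₀ (hQX _), zero_mul] at hle
      exact le_antisymm hle (hQ0 w)
  refine coverProb_eq_zero fun t _ => ?_
  unfold pValue
  rw [Finset.sum_eq_zero, Finset.sum_eq_zero]
  · simpa using hε
  · intro w _
    split_ifs with h
    · exact hnull w h.le
    · rfl
  · intro w _
    split_ifs with h
    · exact hnull w h.le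
    · rfl

lemma eOpt_of_refines [DecidableEq Y] [Nonempty Y] (hQ0 : ∀ z, 0 ≤ Q z) (hQ1 : ∑ z, Q z = 1)
    (hQX : ∀ x, 0 < margX Q x) {c : X → Y} (hc : ∀ x y, Q (x, y) ≤ Q (x, c x))
    (hA : Refines A (MCPMeasure Q c)) : EOpt Q A := by
  classical
  intro B ε hε
  have htop := hasTopLabels_of_refines hQ0 hQX hc hA
  obtain ⟨d, hd, -⟩ := exists_hasTopLabels Q B
  rw [expXT_excess hQ0 htop, expXT_excess hQ0 hd, probXT_empty hQ0 htop, probXT_empty hQ0 hd,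
    sub_le_sub_iff_left]
  have hsum : ∑ z, Q z * coverProb Q A ε z = ∑ z, Q z * coverProb Q B ε z := by
    rw [sum_mul_coverProb hQ1 hε, sum_mul_coverProb hQ1 hε]
  have hψ := coverProb_mem (A := B) hQ0 ε
  have hnn : ∀ z, 0 ≤ coverProb Q A ε z := fun z => (coverProb_mem hQ0 ε z).1
  have hqpos : ∀ z, 0 < coverProb Q A ε z → 0 < condQ Q z := by
    intro z hz
    refine div_pos (lt_of_le_of_ne (hQ0 z) fun h => hz.ne' ?_) (hQX _)
    exact coverProb_eq_zero_of_null hQ0 hQX hc hA hε.1.le h.symm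
  have hlt : ∀ z₀ z : X × Y, 0 < condQ Q z₀ →
      ((condQ Q z₀)⁻¹ * Q z < margX Q z.1 ↔ condQ Q z < condQ Q z₀) := by
    intro z₀ z h
    rw [inv_mul_lt_iff₀ h, condQ.eq_1 Q z, div_lt_iff₀ (hQX _)]
  have hgt : ∀ z₀ z : X × Y, 0 < condQ Q z₀ →
      (margX Q z.1 < (condQ Q z₀)⁻¹ * Q z ↔ condQ Q z₀ < condQ Q z) := by
    intro z₀ z h
    rw [lt_inv_mul_iff₀ h, condQ.eq_1 Q z, lt_div_iff₀ (hQX _)]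
  by_cases hex : ∃ z : X × Y, z.2 ≠ c z.1 ∧ 0 < coverProb Q A ε z
  · obtain ⟨z₁, hz₁⟩ := hex
    obtain ⟨z₀, hz₀, hmin⟩ := Finset.exists_min_image
      (Finset.univ.filter fun z : X × Y => z.2 ≠ c z.1 ∧ 0 < coverProb Q A ε z) (condQ Q)
      ⟨z₁, by simpa using hz₁⟩
    simp only [Finset.mem_filter, Finset.mem_univ, true_and, and_imp] at hz₀ hmin
    have hq := hqpos z₀ hz₀.2
    refine lex_le_of_full (l := (condQ Q z₀)⁻¹) hQ0 hQX hc (inv_pos.mpr hq) ?_ ?_ ?_ hψ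
      (fun x y => coverProb_mono hQ0 ε (hd x y)) hsum
    · intro x
      exact coverProb_eq_one_of_lt hQ0 (hA _ _ ((MCPMeasure_neg hQ0 hQX hc hz₀.1).trans
        (MCPMeasure_pos (z := (x, c x)) hQ0 hQX hc rfl))) hz₀.2
    · intro x y hy h
      rw [hlt z₀ (x, y) hq] at h
      by_contra hne
      exact (hmin (x, y) hy (lt_of_le_of_ne (hnn _) (Ne.symm hne))).not_gt h
    · intro x y hy h
      rw [hgt z₀ (x, y) hq] at h
      refine coverProb_eq_one_of_lt hQ0 (hA _ _ ?_) hz₀.2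
      rw [MCPMeasure, MCPMeasure, if_neg hz₀.1, if_neg hy]
      linarith
  · push Not at hex
    have hφ : ∀ x y, y ≠ c x → coverProb Q A ε (x, y) = 0 := fun x y hy =>
      le_antisymm (hex (x, y) hy) (hnn _)
    have hpos : ∃ x, 0 < coverProb Q A ε (x, c x) := by
      by_contra! hcon
      have h0 : ∑ z, Q z * coverProb Q A ε z = 0 := by
        refine Finset.sum_eq_zero fun z _ => ?_
        obtain ⟨x, y⟩ := z
        by_cases hy : y = c x
        · rw [hy, le_antisymm (hcon x) (hnn _), mul_zero]
        · rw [hφ x y hy, mul_zero]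
      rw [sum_mul_coverProb hQ1 hε] at h0
      linarith [hε.2]
    obtain ⟨x₁, hx₁⟩ := hpos
    obtain ⟨x₀, hx₀, hmin⟩ := Finset.exists_min_image
      (Finset.univ.filter fun x => 0 < coverProb Q A ε (x, c x)) (fun x => condQ Q (x, c x))
      ⟨x₁, by simpa using hx₁⟩
    simp only [Finset.mem_filter, Finset.mem_univ, true_and] at hx₀ hmin
    have hq := hqpos _ hx₀
    refine lex_le_of_supported (l := (condQ Q (x₀, c x₀))⁻¹) hQX hc (inv_pos.mpr hq).le hφ ?_ ?_
      hψ hsum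
    · intro x h
      rw [hlt _ (x, c x) hq] at h
      by_contra hne
      exact (hmin x (lt_of_le_of_ne (hnn _) (Ne.symm hne))).not_gt h
    · intro x h
      rw [hgt _ (x, c x) hq] at h
      refine coverProb_eq_one_of_lt hQ0 (hA _ _ ?_) hx₀
      simpa [MCPMeasure] using h

/-- Sorting by the ratio `Q / a` uniquely minimises the `a`-weighted mass of preceding examples. -/
lemma lt_of_sum_precKernel_le {ι : Type*} [Fintype ι] {a Q A B : ι → ℝ}
    (hB : ∀ z w, a w * Q z < a z * Q w → B z < B w)
    (hle : ∑ z, a z * ∑ w, Q w * precKernel A w z ≤ ∑ z, a z * ∑ w, Q w * precKernel B w z)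
    {z w : ι} (h : a w * Q z < a z * Q w) : A z < A w := by
  by_contra! hcon
  have hsym : ∀ C : ι → ℝ, 2 * ∑ z, a z * ∑ w, Q w * precKernel C w z
      = ∑ p : ι × ι, (a p.2 * Q p.1 + (a p.1 * Q p.2 - a p.2 * Q p.1) * precKernel C p.2 p.1) := by
    intro C
    have h1 : ∑ z, a z * ∑ w, Q w * precKernel C w z
        = ∑ z, ∑ w, a z * (Q w * precKernel C w z) :=
      Finset.sum_congr rfl fun z _ => Finset.mul_sum _ _ _
    rw [two_mul]
    nth_rewrite 2 [h1]
    rw [Finset.sum_comm, h1, Fintype.sum_prod_type, ← Finset.sum_add_distrib]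
    refine Finset.sum_congr rfl fun z _ => ?_
    rw [← Finset.sum_add_distrib]
    refine Finset.sum_congr rfl fun w _ => ?_
    have := precKernel_add_swap C w z
    rw [show precKernel C z w = 1 - precKernel C w z by linarith]
    ring
  have hterm : ∀ z w, (a z * Q w - a w * Q z) * precKernel B w z
      ≤ (a z * Q w - a w * Q z) * precKernel A w z := by
    intro z w
    rcases lt_trichotomy (a w * Q z) (a z * Q w) with h' | h' | h'
    · rw [precKernel_eq_zero (hB z w h'), mul_zero]
      exact mul_nonneg (sub_nonneg.mpr h'.le) (precKernel_nonneg A w z)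
    · simp [h']
    · have h1 := precKernel_add_swap B w z
      rw [precKernel_eq_zero (hB w z h'), add_zero] at h1
      have h2 := precKernel_add_swap A w z
      have h3 := precKernel_nonneg A z w
      rw [h1]
      nlinarith
  have hlt : ∑ p : ι × ι, (a p.2 * Q p.1 + (a p.1 * Q p.2 - a p.2 * Q p.1) * precKernel B p.2 p.1)
      < ∑ p : ι × ι,
        (a p.2 * Q p.1 + (a p.1 * Q p.2 - a p.2 * Q p.1) * precKernel A p.2 p.1) := by
    refine Finset.sum_lt_sum (fun p _ => by linarith [hterm p.1 p.2])
      ⟨(z, w), Finset.mem_univ _, ?_⟩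
    dsimp only
    rw [precKernel_eq_zero (hB z w h)]
    have := mul_pos (sub_pos.mpr h) (precKernel_pos hcon)
    linarith
  rw [← hsym, ← hsym] at hlt
  linarith

/-- The top labels, with ties broken by `Q`, of an F-optimal conformity measure are the most
probable ones. -/
lemma FOpt.le_top [DecidableEq Y] (hQ0 : ∀ z, 0 ≤ Q z) (hQX : ∀ x, 0 < margX Q x) (hA : FOpt Q A)
    {c : X → Y} (hc : HasTopLabels A c)
    (htie : ∀ x y, A (x, y) = A (x, c x) → Q (x, y) ≤ Q (x, c x)) (x : X) (y : Y) :
    Q (x, y) ≤ Q (x, c x) := by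
  classical
  by_contra! hlt
  have hAlt : A (x, y) < A (x, c x) :=
    lt_of_le_of_ne (hc x y) fun h => (htie x y h).not_gt hlt
  have hyc : y ≠ c x := by
    rintro rfl
    exact hlt.false
  set σ : Equiv.Perm (X × Y) := Equiv.swap (x, c x) (x, y) with hσ
  have hσ1 : ∀ z, (σ z).1 = z.1 := by
    intro z
    rw [hσ, Equiv.swap_apply_def]
    split_ifs with h1 h2
    · rw [h1]
    · rw [h2]
    · rfl
  have hσu : σ (x, c x) = (x, y) := Equiv.swap_apply_left _ _
  have hσv : σ (x, y) = (x, c x) := Equiv.swap_apply_right _ _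
  have hσσ : ∀ z, σ (σ z) = z := fun z => by simp [hσ]
  set d : X → Y := Function.update c x y with hdef
  have hgraph : ∀ x', σ (x', d x') = (x', c x') := by
    intro x'
    by_cases hx : x' = x
    · subst hx
      simp [hdef, hσv]
    · rw [hdef, Function.update_of_ne hx, hσ]
      exact Equiv.swap_apply_of_ne_of_ne (by simp [hx]) (by simp [hx])
  have hd : HasTopLabels (A ∘ σ) d := by
    intro x' y'
    rw [Function.comp_apply, Function.comp_apply, hgraph]
    have h1 : σ (x', y') = (x', (σ (x', y')).2) := Prod.ext (hσ1 _) rfl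
    rw [h1]
    exact hc _ _
  have hcond : ∀ z : X × Y, (σ z).2 = d z.1 ↔ z.2 = c z.1 := by
    intro z
    constructor
    · intro h
      have h1 : σ z = (z.1, d z.1) := Prod.ext (hσ1 z) h
      have h2 := hσσ z
      rw [h1, hgraph] at h2
      exact (congrArg Prod.snd h2).symm
    · intro h
      have h1 : z = (z.1, c z.1) := Prod.ext rfl h
      have h2 : σ z = (z.1, d z.1) := (congrArg σ (h1.trans (hgraph z.1).symm)).trans (hσσ _)
      rw [h2]
  have hmean : ∀ z, meanPValue Q A z - meanPValue Q (A ∘ σ) (σ z)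
      = (Q (x, y) - Q (x, c x)) * (precKernel A (x, y) z - precKernel A (x, c x) z) := by
    intro z
    rw [meanPValue_eq, meanPValue_eq,
      ← Equiv.sum_comp σ (fun w => Q w * precKernel (A ∘ σ) w (σ z)),
      ← Finset.sum_sub_distrib]
    have hk : ∀ w, precKernel (A ∘ σ) (σ w) (σ z) = precKernel A w z := by
      intro w
      simp only [precKernel, Function.comp_apply, hσσ]
    simp only [hk]
    rw [Finset.sum_eq_add (x, c x) (x, y) (by simpa using hyc.symm) _ (by simp) (by simp), hσu, hσv]
    · ring
    · intro w _ hw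
      rw [hσ, Equiv.swap_apply_of_ne_of_ne hw.1 hw.2, sub_self]
  have hmean_le : ∀ z, meanPValue Q (A ∘ σ) (σ z) ≤ meanPValue Q A z := by
    intro z
    have := mul_nonneg (sub_nonneg.mpr hlt.le)
      (sub_nonneg.mpr (precKernel_anti_left hAlt.le z))
    linarith [hmean z]
  have hcost : offCost Q d (meanPValue Q (A ∘ σ)) < offCost Q c (meanPValue Q A) := by
    rw [offCost, ← Equiv.sum_comp σ]
    simp only [hσ1, hcond]
    refine Finset.sum_lt_sum (fun z _ => ?_) ⟨(x, y), Finset.mem_univ _, ?_⟩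
    · refine mul_le_mul_of_nonneg_left ?_ (hQX _).le
      split_ifs
      · rfl
      · exact hmean_le z
    · dsimp only
      rw [if_neg hyc, if_neg hyc]
      refine mul_lt_mul_of_pos_left ?_ (hQX x)
      have h1 := hmean (x, y)
      rw [precKernel_eq_zero hAlt, sub_zero] at h1
      have := mul_pos (sub_pos.mpr hlt) (precKernel_pos (le_refl (A (x, y))))
      linarith
  have := hA (A ∘ σ)
  rw [expXT_fuzziness hQ0 hc, expXT_fuzziness hQ0 hd] at this
  rcases this with h | h
  · exact h.not_gt hcost
  · exact hcost.ne' h.1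

lemma onCost_add_mul_offCost [DecidableEq Y] (L : ℝ) (c : X → Y) (f : X × Y → ℝ) :
    onCost Q c f + L * offCost Q c f
      = ∑ z : X × Y, (margX Q z.1 * if z.2 = c z.1 then 1 else L) * f z := by
  have hon : onCost Q c f = ∑ z : X × Y, margX Q z.1 * (if z.2 = c z.1 then f z else 0) := by
    rw [Fintype.sum_prod_type]
    exact Finset.sum_congr rfl fun x _ => by simp
  rw [hon, offCost, Finset.mul_sum, ← Finset.sum_add_distrib]
  refine Finset.sum_congr rfl fun z _ => ?_
  split_ifs <;> ring

lemma FOpt.refines [DecidableEq Y] (hQ0 : ∀ z, 0 ≤ Q z) (hQX : ∀ x, 0 < margX Q x) (hA : FOpt Q A)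
    {c : X → Y} (hc : HasTopLabels A c) (hmax : ∀ x y, Q (x, y) ≤ Q (x, c x)) :
    Refines A (MCPMeasure Q c) := by
  have hB := hasTopLabels_of_refines (A := MCPMeasure Q c) hQ0 hQX hmax fun _ _ h => h
  have hopt := hA (MCPMeasure Q c)
  rw [expXT_fuzziness hQ0 hc, expXT_fuzziness hQ0 hB, expXT_maxPV hQ0 hc,
    expXT_maxPV hQ0 hB] at hopt
  have hqpos : ∀ x, 0 < condQ Q (x, c x) := fun x =>
    div_pos (pos_of_forall_le hQ0 hQX hmax x) (hQX x)
  obtain ⟨L, hL0, hL, hcost⟩ : ∃ L : ℝ, 0 < L ∧ (∀ x, 1 ≤ L * condQ Q (x, c x)) ∧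
      onCost Q c (meanPValue Q A) + L * offCost Q c (meanPValue Q A)
        ≤ onCost Q c (meanPValue Q (MCPMeasure Q c))
          + L * offCost Q c (meanPValue Q (MCPMeasure Q c)) := by
    set s := ∑ x, (condQ Q (x, c x))⁻¹ with hs
    have hs0 : 0 ≤ s := Finset.sum_nonneg fun x _ => (inv_pos.mpr (hqpos x)).le
    have hsx : ∀ x, ∀ L, s ≤ L → 1 ≤ L * condQ Q (x, c x) := by
      intro x L hL
      rw [← inv_le_iff_one_le_mul₀ (hqpos x)]
      exact (Finset.single_le_sum (f := fun x => (condQ Q (x, c x))⁻¹)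
        (fun x _ => (inv_pos.mpr (hqpos x)).le) (Finset.mem_univ x)).trans hL
    rcases hopt with h | ⟨h, h'⟩
    · set r := (onCost Q c (meanPValue Q A) - onCost Q c (meanPValue Q (MCPMeasure Q c)))
        / (offCost Q c (meanPValue Q (MCPMeasure Q c)) - offCost Q c (meanPValue Q A)) with hr
      refine ⟨max (s + 1) r, lt_max_of_lt_left (by linarith),
        fun x => hsx x _ (le_max_of_le_left (by linarith)), ?_⟩
      have h1 := le_max_right (s + 1) r
      nth_rewrite 1 [hr] at h1
      rw [div_le_iff₀ (sub_pos.mpr h)] at h1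
      linarith
    · exact ⟨s + 1, by linarith, fun x => hsx x _ (by linarith), by rw [h]; linarith⟩
  rw [onCost_add_mul_offCost, onCost_add_mul_offCost] at hcost
  simp only [meanPValue_eq] at hcost
  have hlt1 : ∀ z : X × Y, z.2 ≠ c z.1 → condQ Q z < 1 := fun z hz =>
    condQ_lt_one hQ0 hQX hz (pos_of_forall_le hQ0 hQX hmax z.1)
  have hL1 : ∀ z : X × Y, z.2 = c z.1 → 1 ≤ L * condQ Q z := by
    rintro ⟨x, y⟩ h
    obtain rfl : y = c x := h
    exact hL x
  have hratio : ∀ z w : X × Y,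
      (margX Q w.1 * if w.2 = c w.1 then 1 else L) * Q z
          < (margX Q z.1 * if z.2 = c z.1 then 1 else L) * Q w
        ↔ MCPMeasure Q c z < MCPMeasure Q c w := by
    intro z w
    have hz : Q z = condQ Q z * margX Q z.1 := (div_mul_cancel₀ _ (hQX _).ne').symm
    have hw : Q w = condQ Q w * margX Q w.1 := (div_mul_cancel₀ _ (hQX _).ne').symm
    have hm := mul_pos (hQX z.1) (hQX w.1)
    have hred : ∀ s t : ℝ, (margX Q w.1 * s) * Q z < (margX Q z.1 * t) * Q w
        ↔ s * condQ Q z < t * condQ Q w := by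
      intro s t
      have hs : (margX Q w.1 * s) * Q z = (margX Q z.1 * margX Q w.1) * (s * condQ Q z) := by
        rw [hz]
        ring
      have ht : (margX Q z.1 * t) * Q w = (margX Q z.1 * margX Q w.1) * (t * condQ Q w) := by
        rw [hw]
        ring
      rw [hs, ht, mul_lt_mul_iff_right₀ hm]
    rw [hred]
    by_cases hzc : z.2 = c z.1 <;> by_cases hwc : w.2 = c w.1
    · simp [MCPMeasure, hzc, hwc]
    · have h1 := hlt1 w hwc
      have h2 := hL1 z hzc
      have h3 := MCPMeasure_neg hQ0 hQX hmax hwc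
      have h4 := MCPMeasure_pos hQ0 hQX hmax hzc
      rw [if_pos hzc, if_neg hwc]
      constructor <;> intro h <;> linarith
    · have h1 := hlt1 z hzc
      have h2 := hL1 w hwc
      have h3 := MCPMeasure_neg hQ0 hQX hmax hzc
      have h4 := MCPMeasure_pos hQ0 hQX hmax hwc
      rw [if_neg hzc, if_pos hwc]
      constructor <;> intro h <;> linarith
    · simp [MCPMeasure, hzc, hwc, hL0]
  intro z w h
  exact lt_of_sum_precKernel_le (fun z w h => (hratio z w).mp h) hcost ((hratio z w).mpr h)

end Conformity

/-- **Theorem 3 (Vovk et al.):** `O(F) = O(E) = R(MCP)`. -/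
theorem stmt2 {X Y : Type*} [Fintype X] [Fintype Y] [DecidableEq Y] [Nonempty X]
    (hY : 2 ≤ Fintype.card Y) (Q : X × Y → ℝ) (hQ0 : ∀ z, 0 ≤ Q z)
    (hQ1 : ∑ z : X × Y, Q z = 1) (hQX : ∀ x, 0 < margX Q x) (A : X × Y → ℝ) :
    (FOpt Q A ↔ EOpt Q A) ∧
      (EOpt Q A ↔ ∃ c : X → Y, IsChoiceFun Q c ∧ Refines A (MCPMeasure Q c)) := by
  have : Nonempty Y := Fintype.card_pos_iff.mp (by lia)
  have hFR : FOpt Q A → ∃ c : X → Y, IsChoiceFun Q c ∧ Refines A (MCPMeasure Q c) := by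
    intro hA
    obtain ⟨c, hc, htie⟩ := exists_hasTopLabels Q A
    have hmax := hA.le_top hQ0 hQX hc htie
    exact ⟨c, isChoiceFun_of_le hQX hmax, hA.refines hQ0 hQX hc hmax⟩
  have hRE : (∃ c : X → Y, IsChoiceFun Q c ∧ Refines A (MCPMeasure Q c)) → EOpt Q A :=
    fun ⟨_, hc, hr⟩ => eOpt_of_refines hQ0 hQ1 hQX (hc.le hQX) hr
  have hEF : EOpt Q A → FOpt Q A := fun h => h.fOpt hQ0 hQ1
  exact ⟨⟨fun h => hRE (hFR h), hEF⟩, fun h => hFR (hEF h), hRE⟩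
end

section
/- In the label-conditional setting, an idealised conformity measure A is label-conditionally S-optimal if and only if it is label-conditionally OF-optimal, if and only if it is label-conditionally N-optimal, if and only if it is label-conditionally OE-optimal, if and only if A is a label-conditional refinement of the CP idealised conformity measure; that is, O_lc(S) = O_lc(OF) = O_lc(N) = O_lc(OE) = R_lc(CP). -/
noncomputable section LabelConditional

open Finset

variable {X Y : Type*} [Fintype X] [Fintype Y] [DecidableEq Y]

/-- The label-conditional p-value. -/
def lcPValue (Q A : X × Y → ℝ) (x : X) (y : Y) (τ : ℝ) : ℝ :=
  ((∑ x' : X, if A (x', y) < A (x, y) then Q (x', y) else 0)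
      + τ * ∑ x' : X, if A (x', y) = A (x, y) then Q (x', y) else 0) / margY Q y

/-- The label-conditional prediction set. -/
def lcPredSet (Q A : X × Y → ℝ) (ε : ℝ) (x : X) (τ : ℝ) : Finset Y :=
  Finset.univ.filter fun y => ε < lcPValue Q A x y τ

/-- `A` is a label-conditional refinement of `B`. -/
def lcRefines (A B : X × Y → ℝ) : Prop :=
  ∀ (x1 x2 : X) (y : Y), B (x1, y) < B (x2, y) → A (x1, y) < A (x2, y)

/-- `max_{y' ≠ y}` of label-conditional p-values. -/
def lcMaxOther (Q A : X × Y → ℝ) (x : X) (y : Y) (τ : ℝ) : ℝ :=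
  ⨆ y' : {y' : Y // y' ≠ y}, lcPValue Q A x y'.1 τ

/-- Label-conditional unconfidence. -/
def lcUnconf (Q A : X × Y → ℝ) (x : X) (τ : ℝ) : ℝ := ⨅ y : Y, lcMaxOther Q A x y τ

/-- Label-conditional credibility. -/
def lcMaxPV (Q A : X × Y → ℝ) (x : X) (τ : ℝ) : ℝ := ⨆ y : Y, lcPValue Q A x y τ

/-- Label-conditional S-optimality. -/
def lcSOpt (Q A : X × Y → ℝ) : Prop :=
  ∀ B : X × Y → ℝ,
    expXT Q (fun x τ => ∑ y, lcPValue Q A x y τ)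
      ≤ expXT Q (fun x τ => ∑ y, lcPValue Q B x y τ)

/-- Label-conditional N-optimality. -/
def lcNOpt (Q A : X × Y → ℝ) : Prop :=
  ∀ B : X × Y → ℝ, ∀ ε ∈ Set.Ioo (0:ℝ) 1,
    expXT Q (fun x τ => ((lcPredSet Q A ε x τ).card : ℝ))
      ≤ expXT Q (fun x τ => ((lcPredSet Q B ε x τ).card : ℝ))

/-- Label-conditional OF-optimality. -/
def lcOFOpt (Q A : X × Y → ℝ) : Prop :=
  ∀ B : X × Y → ℝ,
    expZT Q (fun z τ => ∑ y' ∈ Finset.univ.erase z.2, lcPValue Q A z.1 y' τ)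
      ≤ expZT Q (fun z τ => ∑ y' ∈ Finset.univ.erase z.2, lcPValue Q B z.1 y' τ)

/-- Label-conditional OE-optimality. -/
def lcOEOpt (Q A : X × Y → ℝ) : Prop :=
  ∀ B : X × Y → ℝ, ∀ ε ∈ Set.Ioo (0:ℝ) 1,
    expZT Q (fun z τ => (((lcPredSet Q A ε z.1 τ).erase z.2).card : ℝ))
      ≤ expZT Q (fun z τ => (((lcPredSet Q B ε z.1 τ).erase z.2).card : ℝ))

/-- Label-conditional U-optimality. -/
def lcUOpt (Q A : X × Y → ℝ) : Prop :=
  ∀ B : X × Y → ℝ,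
    expXT Q (lcUnconf Q A) < expXT Q (lcUnconf Q B) ∨
      (expXT Q (lcUnconf Q A) = expXT Q (lcUnconf Q B) ∧
        expXT Q (lcMaxPV Q A) ≤ expXT Q (lcMaxPV Q B))

/-- Label-conditional M-optimality. -/
def lcMOpt (Q A : X × Y → ℝ) : Prop :=
  ∀ B : X × Y → ℝ, ∀ ε ∈ Set.Ioo (0:ℝ) 1,
    probXT Q (fun x τ => 1 < (lcPredSet Q A ε x τ).card)
        < probXT Q (fun x τ => 1 < (lcPredSet Q B ε x τ).card) ∨
      (probXT Q (fun x τ => 1 < (lcPredSet Q A ε x τ).card)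
          = probXT Q (fun x τ => 1 < (lcPredSet Q B ε x τ).card) ∧
        probXT Q (fun x τ => (lcPredSet Q B ε x τ).card = 0)
          ≤ probXT Q (fun x τ => (lcPredSet Q A ε x τ).card = 0))

/-- Label-conditional F-optimality. -/
def lcFOpt (Q A : X × Y → ℝ) : Prop :=
  ∀ B : X × Y → ℝ,
    expXT Q (fun x τ => (∑ y, lcPValue Q A x y τ) - lcMaxPV Q A x τ)
        < expXT Q (fun x τ => (∑ y, lcPValue Q B x y τ) - lcMaxPV Q B x τ) ∨
      (expXT Q (fun x τ => (∑ y, lcPValue Q A x y τ) - lcMaxPV Q A x τ)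
          = expXT Q (fun x τ => (∑ y, lcPValue Q B x y τ) - lcMaxPV Q B x τ) ∧
        expXT Q (lcMaxPV Q A) ≤ expXT Q (lcMaxPV Q B))

/-- Label-conditional E-optimality. -/
def lcEOpt (Q A : X × Y → ℝ) : Prop :=
  ∀ B : X × Y → ℝ, ∀ ε ∈ Set.Ioo (0:ℝ) 1,
    expXT Q (fun x τ => max (((lcPredSet Q A ε x τ).card : ℝ) - 1) 0)
        < expXT Q (fun x τ => max (((lcPredSet Q B ε x τ).card : ℝ) - 1) 0) ∨
      (expXT Q (fun x τ => max (((lcPredSet Q A ε x τ).card : ℝ) - 1) 0)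
          = expXT Q (fun x τ => max (((lcPredSet Q B ε x τ).card : ℝ) - 1) 0) ∧
        probXT Q (fun x τ => (lcPredSet Q B ε x τ).card = 0)
          ≤ probXT Q (fun x τ => (lcPredSet Q A ε x τ).card = 0))

/-- Label-conditional OU-optimality. -/
def lcOUOpt (Q A : X × Y → ℝ) : Prop :=
  ∀ B : X × Y → ℝ,
    expZT Q (fun z τ => lcMaxOther Q A z.1 z.2 τ)
      ≤ expZT Q (fun z τ => lcMaxOther Q B z.1 z.2 τ)

/-- Label-conditional OM-optimality. -/
def lcOMOpt (Q A : X × Y → ℝ) : Prop :=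
  ∀ B : X × Y → ℝ, ∀ ε ∈ Set.Ioo (0:ℝ) 1,
    probZT Q (fun z τ => ((lcPredSet Q A ε z.1 τ).erase z.2).Nonempty)
      ≤ probZT Q (fun z τ => ((lcPredSet Q B ε z.1 τ).erase z.2).Nonempty)

end LabelConditional

section NeymanPearson

open MeasureTheory

lemma integral_ite_lt (e l r : ℝ) (h : l ≤ r) :
    ∫ u in l..r, (if e < u then (1 : ℝ) else 0) = max r e - max l e := by
  have hfun : (fun u : ℝ => if e < u then (1 : ℝ) else 0)
      = (Set.Ioi e).indicator (fun _ => (1 : ℝ)) := by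
    ext u; simp [Set.indicator_apply]
  rw [hfun, intervalIntegral.integral_of_le h, setIntegral_indicator measurableSet_Ioi,
    Set.Ioc_inter_Ioi]
  simp only [integral_const, MeasurableSet.univ, measureReal_restrict_apply, Set.univ_inter,
    Real.volume_real_Ioc, smul_eq_mul, mul_one]
  grind

lemma mul_integral_ite_lt_add_mul (e l b : ℝ) (hb : 0 ≤ b) :
    b * ∫ τ in (0 : ℝ)..1, (if e < l + τ * b then (1 : ℝ) else 0)
      = max (l + b) e - max l e := by
  have h := intervalIntegral.mul_integral_comp_add_mul
    (f := fun u : ℝ => if e < u then (1 : ℝ) else 0) (a := 0) (b := 1) b l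
  simp only [mul_comm b] at h
  rw [mul_comm, h, zero_mul, one_mul, add_zero]
  exact integral_ite_lt e l (l + b) (by linarith)

lemma intervalIntegrable_ite_lt (e : ℝ) {p : ℝ → ℝ} (hp : Measurable p) (a b : ℝ) :
    IntervalIntegrable (fun τ => if e < p τ then (1 : ℝ) else 0) volume a b := by
  refine intervalIntegrable_const (c := (1 : ℝ)) |>.mono_fun ?_ ?_
  · exact (Measurable.ite (measurableSet_lt measurable_const hp) measurable_const
      measurable_const).aestronglyMeasurable
  · refine Filter.Eventually.of_forall fun τ => ?_
    dsimp only
    split_ifs <;> simp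

lemma antitone_integral_ite_lt {p : ℝ → ℝ} (hp : Measurable p) :
    Antitone fun e => ∫ τ in (0 : ℝ)..1, (if e < p τ then (1 : ℝ) else 0) := by
  intro e e' h
  refine intervalIntegral.integral_mono_on zero_le_one (intervalIntegrable_ite_lt _ hp _ _)
    (intervalIntegrable_ite_lt _ hp _ _) fun τ _ => ?_
  by_cases h1 : e' < p τ
  · simp [h1, h.trans_lt h1]
  · simp only [h1, if_false]
    split_ifs <;> norm_num

lemma integral_integral_ite_lt {p : ℝ → ℝ} (hp : Measurable p)
    (h01 : ∀ τ ∈ Set.Icc (0 : ℝ) 1, p τ ∈ Set.Icc (0 : ℝ) 1) :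
    ∫ e in (0 : ℝ)..1, ∫ τ in (0 : ℝ)..1, (if e < p τ then (1 : ℝ) else 0)
      = ∫ τ in (0 : ℝ)..1, p τ := by
  have hswap : ∫ e in (0 : ℝ)..1, ∫ τ in (0 : ℝ)..1, (if e < p τ then (1 : ℝ) else 0)
      = ∫ τ in (0 : ℝ)..1, ∫ e in (0 : ℝ)..1, (if e < p τ then (1 : ℝ) else 0) := by
    simp only [intervalIntegral.integral_of_le zero_le_one]
    refine integral_integral_swap ?_
    refine Integrable.of_bound (C := 1) ?_ ?_
    · exact (Measurable.ite (measurableSet_lt measurable_fst (hp.comp measurable_snd))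
        measurable_const measurable_const).aestronglyMeasurable
    · refine Filter.Eventually.of_forall fun z => ?_
      dsimp only [Function.uncurry]
      split_ifs <;> simp
  rw [hswap]
  refine intervalIntegral.integral_congr fun τ hτ => ?_
  rw [Set.uIcc_of_le zero_le_one] at hτ
  obtain ⟨h0, h1⟩ := h01 τ hτ
  have hfun : (fun e : ℝ => if e < p τ then (1 : ℝ) else 0)
      = (Set.Iio (p τ)).indicator (fun _ => (1 : ℝ)) := by
    ext u; simp [Set.indicator_apply]
  have hae : (Set.Ioc (0 : ℝ) 1 ∩ Set.Iio (p τ) : Set ℝ) =ᵐ[volume] Set.Ioc 0 (p τ) := by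
    have : (Set.Ioc (0 : ℝ) 1 ∩ Set.Iio (p τ) : Set ℝ) = Set.Ioo 0 (p τ) := by
      ext u
      simp only [Set.mem_inter_iff, Set.mem_Ioc, Set.mem_Iio, Set.mem_Ioo]
      constructor
      · rintro ⟨⟨a, _⟩, c⟩; exact ⟨a, c⟩
      · rintro ⟨a, c⟩; exact ⟨⟨a, by linarith⟩, c⟩
    rw [this]
    exact Ioo_ae_eq_Ioc
  rw [hfun, intervalIntegral.integral_of_le zero_le_one, setIntegral_indicator measurableSet_Iio,
    setIntegral_congr_set hae]
  simp [h0]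

lemma sum_telescope_levels (g w : ℝ → ℝ) (V : Finset ℝ) :
    ∑ v ∈ V, (g (∑ u ∈ V with u < v, w u + w v) - g (∑ u ∈ V with u < v, w u))
      = g (∑ u ∈ V, w u) - g 0 := by
  induction V using Finset.induction_on_max with
  | empty => simp
  | insert a s hs ih =>
    have ha : a ∉ s := fun h => lt_irrefl _ (hs a h)
    have h1 : ({u ∈ insert a s | u < a} : Finset ℝ) = s := by
      rw [Finset.filter_insert, if_neg (lt_irrefl a)]
      exact Finset.filter_true_of_mem hs
    have h2 : ∀ v ∈ s, ({u ∈ insert a s | u < v} : Finset ℝ) = {u ∈ s | u < v} := fun v hv => by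
      rw [Finset.filter_insert, if_neg (hs v hv).le.not_gt]
    have h3 : ∑ v ∈ s, (g (∑ u ∈ insert a s with u < v, w u + w v)
        - g (∑ u ∈ insert a s with u < v, w u)) = g (∑ u ∈ s, w u) - g 0 := by
      rw [← ih]
      exact Finset.sum_congr rfl fun v hv => by rw [h2 v hv]
    rw [Finset.sum_insert ha, h3, Finset.sum_insert ha, h1, add_comm (w a)]
    ring

/-- Validity of smoothed p-values: the event `p > e` has probability exactly `1 - e`
(up to the total mass, which is not normalised here). -/
lemma sum_mul_integral_pass {X : Type*} [Fintype X] (q a : X → ℝ) (hq : ∀ x, 0 ≤ q x)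
    (e : ℝ) (he0 : 0 ≤ e) (he1 : e ≤ ∑ x, q x) :
    ∑ x, q x * ∫ τ in (0 : ℝ)..1,
        (if e < (∑ x', if a x' < a x then q x' else 0)
          + τ * ∑ x', (if a x' = a x then q x' else 0) then (1 : ℝ) else 0)
      = ∑ x, q x - e := by
  classical
  set w : ℝ → ℝ := fun v => ∑ x', if a x' = v then q x' else 0 with hw
  set V : Finset ℝ := Finset.univ.image a with hV
  have hmem : ∀ x, a x ∈ V := fun x => Finset.mem_image_of_mem a (Finset.mem_univ x)
  have hlow : ∀ v, (∑ x', if a x' < v then q x' else 0) = ∑ u ∈ V with u < v, w u := by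
    intro v
    simp only [hw]
    rw [Finset.sum_comm]
    refine Finset.sum_congr rfl fun x _ => ?_
    rw [Finset.sum_ite_eq]
    simp [hmem x]
  have htot : ∑ x, q x = ∑ u ∈ V, w u := by
    simp only [hw]
    rw [Finset.sum_comm]
    refine Finset.sum_congr rfl fun x _ => ?_
    rw [Finset.sum_ite_eq, if_pos (hmem x)]
  have hw0 : ∀ v, 0 ≤ w v := fun v => Finset.sum_nonneg fun x _ => by
    split_ifs
    exacts [hq x, le_rfl]
  set φ : ℝ → ℝ := fun v => ∫ τ in (0 : ℝ)..1,
    (if e < (∑ u ∈ V with u < v, w u) + τ * w v then (1 : ℝ) else 0) with hφ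
  have hgroup : ∑ x, q x * φ (a x) = ∑ v ∈ V, w v * φ v := by
    simp only [hw, Finset.sum_mul]
    rw [Finset.sum_comm]
    refine Finset.sum_congr rfl fun x _ => ?_
    simp only [ite_mul, zero_mul]
    rw [Finset.sum_ite_eq, if_pos (hmem x)]
  simp only [hlow]
  change ∑ x, q x * φ (a x) = _
  rw [hgroup, Finset.sum_congr rfl fun v _ => mul_integral_ite_lt_add_mul e _ (w v) (hw0 v),
    sum_telescope_levels (fun t => max t e) w V, ← htot, max_eq_left he1, max_eq_right he0]

/-- The Neyman–Pearson comparison: a test `φ` that rejects in the order of the likelihood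
ratio `q / m` minimises `∑ m φ` among tests with the same nontrivial `∑ q φ`. -/
lemma neyman_pearson {X : Type*} [Fintype X] {q m φ ψ : X → ℝ} (hq : ∀ x, 0 ≤ q x)
    (hm : ∀ x, 0 < m x) (hφ0 : ∀ x, 0 ≤ φ x) (hψ0 : ∀ x, 0 ≤ ψ x)
    (hψ1 : ∀ x, ψ x ≤ 1) (hmono : ∀ x x', q x / m x < q x' / m x' → 0 < φ x → φ x' = 1)
    (heq : ∑ x, q x * φ x = ∑ x, q x * ψ x) (hpos : 0 < ∑ x, q x * φ x)
    (hlt : ∑ x, q x * φ x < ∑ x, q x) :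
    ∑ x, m x * φ x ≤ ∑ x, m x * ψ x := by
  classical
  have hne : ({x | 0 < φ x} : Finset X).Nonempty := by
    by_contra h
    rw [Finset.not_nonempty_iff_eq_empty, Finset.filter_eq_empty_iff] at h
    refine hpos.ne' (Finset.sum_eq_zero fun x _ => ?_)
    rw [le_antisymm (not_lt.mp (h (Finset.mem_univ x))) (hφ0 x), mul_zero]
  obtain ⟨x₀, hx₀, hmin⟩ := Finset.exists_min_image _ (fun x => q x / m x) hne
  have hx₀ : 0 < φ x₀ := by simpa using hx₀
  have hmin : ∀ x, 0 < φ x → q x₀ / m x₀ ≤ q x / m x := fun x hx => hmin x (by simpa using hx)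
  set t := q x₀ / m x₀ with ht
  have ht0 : 0 < t := by
    refine lt_of_le_of_ne (div_nonneg (hq _) (hm _).le) fun h => hlt.ne ?_
    refine Finset.sum_congr rfl fun x _ => ?_
    rcases (hq x).eq_or_lt with h0 | h0
    · rw [← h0, zero_mul]
    · rw [hmono x₀ x (by rw [← ht, ← h]; exact div_pos h0 (hm x)) hx₀, mul_one]
  have hterm : ∀ x, 0 ≤ (q x - t * m x) * (φ x - ψ x) := by
    intro x
    rcases lt_trichotomy (q x / m x) t with h | h | h
    · have h0 : φ x = 0 := le_antisymm (not_lt.mp fun hx => (hmin x hx).not_gt h) (hφ0 x)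
      rw [div_lt_iff₀ (hm x)] at h
      have := hψ0 x
      rw [h0]
      nlinarith
    · rw [div_eq_iff (hm x).ne'] at h
      rw [h, sub_self, zero_mul]
    · have h1 := hmono x₀ x h hx₀
      rw [lt_div_iff₀ (hm x)] at h
      rw [h1]
      exact mul_nonneg (by linarith) (by linarith [hψ1 x])
  have hsum := Finset.sum_nonneg fun x (_ : x ∈ Finset.univ) => hterm x
  have hexp : ∑ x, (q x - t * m x) * (φ x - ψ x)
      = (∑ x, q x * φ x - ∑ x, q x * ψ x) - t * (∑ x, m x * φ x - ∑ x, m x * ψ x) := by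
    simp only [← Finset.sum_sub_distrib, Finset.mul_sum]
    exact Finset.sum_congr rfl fun x _ => by ring
  rw [hexp, heq, sub_self, zero_sub] at hsum
  by_contra h
  nlinarith

end NeymanPearson

noncomputable section PairCost

variable {X Y : Type*} [Fintype Y]

/-- The smoothed order indicator `[a' < a] + [a' = a] / 2`. -/
def halfOrder (a' a : ℝ) : ℝ := if a' < a then 1 else if a' = a then 1 / 2 else 0

/-- The contribution of the unordered pair `{x, x'}` to twice the expected sum of p-values,
up to the factor `1 / margY Q y`. -/
def pairCost (Q A : X × Y → ℝ) (x x' : X) (y : Y) : ℝ :=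
  margX Q x * Q (x', y) * halfOrder (A (x', y)) (A (x, y))
    + margX Q x' * Q (x, y) * halfOrder (A (x, y)) (A (x', y))

variable {Q : X × Y → ℝ}

lemma pairCost_condQ_le (hQX : ∀ x, 0 < margX Q x) (A : X × Y → ℝ) (x x' : X) (y : Y) :
    pairCost Q (condQ Q) x x' y ≤ pairCost Q A x x' y := by
  have hlt : ∀ u v : X, condQ Q (u, y) < condQ Q (v, y)
      ↔ margX Q v * Q (u, y) < margX Q u * Q (v, y) := fun u v => by
    rw [condQ, condQ, div_lt_div_iff₀ (hQX u) (hQX v), mul_comm, mul_comm (Q (v, y))]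
  have heq : ∀ u v : X, condQ Q (u, y) = condQ Q (v, y)
      ↔ margX Q v * Q (u, y) = margX Q u * Q (v, y) := fun u v => by
    rw [condQ, condQ, div_eq_div_iff (hQX u).ne' (hQX v).ne', mul_comm, mul_comm (Q (v, y))]
  simp only [pairCost, halfOrder, hlt, heq]
  generalize margX Q x * Q (x', y) = s
  generalize margX Q x' * Q (x, y) = t
  split_ifs <;> grind

lemma pairCost_condQ_lt (hQX : ∀ x, 0 < margX Q x) {A : X × Y → ℝ} {x x' : X} {y : Y}
    (h : condQ Q (x, y) < condQ Q (x', y)) (hA : A (x', y) ≤ A (x, y)) :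
    pairCost Q (condQ Q) x x' y < pairCost Q A x x' y := by
  have hst : margX Q x' * Q (x, y) < margX Q x * Q (x', y) := by
    rwa [condQ, condQ, div_lt_div_iff₀ (hQX x) (hQX x'), mul_comm, mul_comm (Q (x', y))] at h
  simp only [pairCost, halfOrder, h, h.not_gt, h.ne', if_true, if_false]
  rcases hA.lt_or_eq with hA | hA
  · simp only [hA, hA.not_gt, hA.ne', if_true, if_false]
    linarith
  · simp only [hA, lt_irrefl, if_true, if_false]
    linarith

end PairCost

noncomputable section LabelConditionalOptimality

open MeasureTheory

variable {X Y : Type*} [Fintype X]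

lemma expXT_sum [Fintype Y] (Q : X × Y → ℝ) (f : X → Y → ℝ → ℝ)
    (hf : ∀ x y, IntervalIntegrable (f x y) volume 0 1) :
    expXT Q (fun x τ => ∑ y, f x y τ)
      = ∑ y, ∑ x, margX Q x * ∫ τ in (0 : ℝ)..1, f x y τ := by
  unfold expXT
  rw [Finset.sum_comm]
  refine Finset.sum_congr rfl fun x _ => ?_
  rw [intervalIntegral.integral_finsetSum fun y _ => hf x y, Finset.mul_sum]

lemma expZT_sum_erase [Fintype Y] [DecidableEq Y] (Q : X × Y → ℝ) (f : X → Y → ℝ → ℝ)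
    (hf : ∀ x y, IntervalIntegrable (f x y) volume 0 1) :
    expZT Q (fun z τ => ∑ y ∈ Finset.univ.erase z.2, f z.1 y τ)
      = expXT Q (fun x τ => ∑ y, f x y τ)
        - ∑ y, ∑ x, Q (x, y) * ∫ τ in (0 : ℝ)..1, f x y τ := by
  have hsum : ∀ x, ∫ τ in (0 : ℝ)..1, ∑ y, f x y τ = ∑ y, ∫ τ in (0 : ℝ)..1, f x y τ :=
    fun x => intervalIntegral.integral_finsetSum fun y _ => hf x y
  have herase : ∀ x y, ∫ τ in (0 : ℝ)..1, ∑ y' ∈ Finset.univ.erase y, f x y' τ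
      = (∫ τ in (0 : ℝ)..1, ∑ y, f x y τ) - ∫ τ in (0 : ℝ)..1, f x y τ := fun x y => by
    rw [intervalIntegral.integral_finsetSum fun y _ => hf x y, hsum,
      Finset.sum_erase_eq_sub (Finset.mem_univ y)]
  unfold expZT expXT
  rw [Fintype.sum_prod_type]
  simp only [herase, mul_sub, Finset.sum_sub_distrib, margX, Finset.sum_mul]
  rw [Finset.sum_comm (f := fun x y => Q (x, y) * ∫ τ in (0 : ℝ)..1, f x y τ)]

lemma measurable_lcPValue (Q A : X × Y → ℝ) (x : X) (y : Y) :
    Measurable (lcPValue Q A x y) := by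
  unfold lcPValue
  fun_prop

lemma intervalIntegrable_lcPValue (Q A : X × Y → ℝ) (x : X) (y : Y) :
    IntervalIntegrable (lcPValue Q A x y) volume 0 1 := by
  refine Continuous.intervalIntegrable ?_ _ _
  unfold lcPValue
  fun_prop

/-- The probability over `τ` that the label `y` is in the prediction set of `x`. -/
def lcPass (Q A : X × Y → ℝ) (ε : ℝ) (x : X) (y : Y) : ℝ :=
  ∫ τ in (0 : ℝ)..1, if ε < lcPValue Q A x y τ then (1 : ℝ) else 0

lemma lcPass_nonneg (Q A : X × Y → ℝ) (ε : ℝ) (x : X) (y : Y) : 0 ≤ lcPass Q A ε x y :=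
  intervalIntegral.integral_nonneg zero_le_one fun τ _ => by split_ifs <;> norm_num

lemma lcPass_le_one (Q A : X × Y → ℝ) (ε : ℝ) (x : X) (y : Y) : lcPass Q A ε x y ≤ 1 := by
  have h := intervalIntegral.integral_mono_on (zero_le_one (α := ℝ))
    (intervalIntegrable_ite_lt ε (measurable_lcPValue Q A x y) 0 1)
    (intervalIntegrable_const (c := (1 : ℝ))) fun τ _ => by split_ifs <;> norm_num
  simpa [lcPass] using h

lemma expXT_card_lcPredSet [Fintype Y] (Q A : X × Y → ℝ) (ε : ℝ) :
    expXT Q (fun x τ => ((lcPredSet Q A ε x τ).card : ℝ))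
      = ∑ y, ∑ x, margX Q x * lcPass Q A ε x y := by
  rw [show (fun x τ => ((lcPredSet Q A ε x τ).card : ℝ))
    = fun x τ => ∑ y, if ε < lcPValue Q A x y τ then (1 : ℝ) else 0 by
      ext x τ; simp [lcPredSet]]
  exact expXT_sum Q _ fun x y => intervalIntegrable_ite_lt ε (measurable_lcPValue Q A x y) 0 1

lemma expZT_card_lcPredSet_erase [Fintype Y] [DecidableEq Y] (Q A : X × Y → ℝ) (ε : ℝ) :
    expZT Q (fun z τ => (((lcPredSet Q A ε z.1 τ).erase z.2).card : ℝ))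
      = expXT Q (fun x τ => ((lcPredSet Q A ε x τ).card : ℝ))
        - ∑ y, ∑ x, Q (x, y) * lcPass Q A ε x y := by
  rw [show (fun x τ => ((lcPredSet Q A ε x τ).card : ℝ))
      = fun x τ => ∑ y, if ε < lcPValue Q A x y τ then (1 : ℝ) else 0 by
        ext x τ; simp [lcPredSet],
    show (fun (z : X × Y) τ => (((lcPredSet Q A ε z.1 τ).erase z.2).card : ℝ))
      = fun z τ => ∑ y ∈ Finset.univ.erase z.2,
          if ε < lcPValue Q A z.1 y τ then (1 : ℝ) else 0 by
        ext z τ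
        rw [Finset.sum_boole, Finset.filter_erase, lcPredSet]]
  exact expZT_sum_erase Q _
    fun x y => intervalIntegrable_ite_lt ε (measurable_lcPValue Q A x y) 0 1

variable {Q : X × Y → ℝ}

lemma sum_mul_lcPass (hQ0 : ∀ z, 0 ≤ Q z) (hQY : ∀ y, 0 < margY Q y) (A : X × Y → ℝ)
    {ε : ℝ} (h0 : 0 ≤ ε) (h1 : ε ≤ 1) (y : Y) :
    ∑ x, Q (x, y) * lcPass Q A ε x y = (1 - ε) * margY Q y := by
  have h := sum_mul_integral_pass (fun x => Q (x, y)) (fun x => A (x, y)) (fun x => hQ0 _)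
    (ε * margY Q y) (mul_nonneg h0 (hQY y).le) (mul_le_of_le_one_left (hQY y).le h1)
  simp only [lcPass, lcPValue, lt_div_iff₀ (hQY y)]
  rw [h, margY]
  ring

lemma lcPValue_mem_Icc (hQ0 : ∀ z, 0 ≤ Q z) (hQY : ∀ y, 0 < margY Q y) (A : X × Y → ℝ)
    (x : X) (y : Y) {τ : ℝ} (hτ : τ ∈ Set.Icc (0 : ℝ) 1) :
    lcPValue Q A x y τ ∈ Set.Icc (0 : ℝ) 1 := by
  have hlow : 0 ≤ ∑ x', if A (x', y) < A (x, y) then Q (x', y) else 0 :=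
    Finset.sum_nonneg fun x' _ => by split_ifs; exacts [hQ0 _, le_rfl]
  have htie : 0 ≤ ∑ x', if A (x', y) = A (x, y) then Q (x', y) else 0 :=
    Finset.sum_nonneg fun x' _ => by split_ifs; exacts [hQ0 _, le_rfl]
  have hle : (∑ x', if A (x', y) < A (x, y) then Q (x', y) else 0)
      + ∑ x', (if A (x', y) = A (x, y) then Q (x', y) else 0) ≤ margY Q y := by
    rw [← Finset.sum_add_distrib, margY]
    refine Finset.sum_le_sum fun x' _ => ?_
    have := hQ0 (x', y)
    split_ifs <;> linarith
  refine ⟨div_nonneg (add_nonneg hlow (mul_nonneg hτ.1 htie)) (hQY y).le, ?_⟩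
  rw [lcPValue, div_le_one (hQY y)]
  nlinarith [hτ.2]

lemma lcPValue_le_of_lt (hQ0 : ∀ z, 0 ≤ Q z) (hQY : ∀ y, 0 < margY Q y) (A : X × Y → ℝ)
    {x x' : X} {y : Y} (hA : A (x, y) < A (x', y)) {τ τ' : ℝ} (hτ : τ ≤ 1) (hτ' : 0 ≤ τ') :
    lcPValue Q A x y τ ≤ lcPValue Q A x' y τ' := by
  unfold lcPValue
  refine div_le_div_of_nonneg_right ?_ (hQY y).le
  rw [Finset.mul_sum, Finset.mul_sum, ← Finset.sum_add_distrib, ← Finset.sum_add_distrib]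
  refine Finset.sum_le_sum fun u _ => ?_
  have h := hQ0 (u, y)
  have h1 := mul_le_mul_of_nonneg_right hτ h
  have h2 := mul_nonneg hτ' h
  simp only [mul_ite, mul_zero]
  split_ifs <;> linarith

lemma lcPass_eq_one_of_lt (hQ0 : ∀ z, 0 ≤ Q z) (hQY : ∀ y, 0 < margY Q y) (A : X × Y → ℝ)
    {ε : ℝ} {x x' : X} {y : Y} (hA : A (x, y) < A (x', y)) (hpos : 0 < lcPass Q A ε x y) :
    lcPass Q A ε x' y = 1 := by
  obtain ⟨τ, hτ, hε⟩ : ∃ τ ∈ Set.Icc (0 : ℝ) 1, ε < lcPValue Q A x y τ := by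
    by_contra! h
    refine hpos.ne' ?_
    rw [lcPass, intervalIntegral.integral_congr (g := fun _ => (0 : ℝ)) fun τ hτ => ?_]
    · simp
    · rw [Set.uIcc_of_le zero_le_one] at hτ
      simp [(h τ hτ).not_gt]
  rw [lcPass, intervalIntegral.integral_congr (g := fun _ => (1 : ℝ)) fun τ' hτ' => ?_]
  · simp
  · rw [Set.uIcc_of_le zero_le_one] at hτ'
    simp [hε.trans_le (lcPValue_le_of_lt hQ0 hQY A hA hτ.2 hτ'.1)]

lemma integral_lcPass (hQ0 : ∀ z, 0 ≤ Q z) (hQY : ∀ y, 0 < margY Q y) (A : X × Y → ℝ)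
    (x : X) (y : Y) :
    ∫ ε in (0 : ℝ)..1, lcPass Q A ε x y = ∫ τ in (0 : ℝ)..1, lcPValue Q A x y τ :=
  integral_integral_ite_lt (measurable_lcPValue Q A x y)
    fun _ hτ => lcPValue_mem_Icc hQ0 hQY A x y hτ

lemma intervalIntegrable_lcPass (Q A : X × Y → ℝ) (x : X) (y : Y) :
    IntervalIntegrable (fun ε => lcPass Q A ε x y) volume 0 1 :=
  (antitone_integral_ite_lt (measurable_lcPValue Q A x y)).intervalIntegrable

lemma integral_sum_mul_lcPass [Fintype Y] (hQ0 : ∀ z, 0 ≤ Q z) (hQY : ∀ y, 0 < margY Q y)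
    (A : X × Y → ℝ) (c : X → Y → ℝ) :
    ∫ ε in (0 : ℝ)..1, ∑ y, ∑ x, c x y * lcPass Q A ε x y
      = ∑ y, ∑ x, c x y * ∫ τ in (0 : ℝ)..1, lcPValue Q A x y τ := by
  have hint : ∀ x y, IntervalIntegrable (fun ε => c x y * lcPass Q A ε x y) volume 0 1 :=
    fun x y => (intervalIntegrable_lcPass Q A x y).const_mul _
  rw [intervalIntegral.integral_finsetSum fun y _ => by
    simpa only [Finset.sum_fn] using
      IntervalIntegrable.sum Finset.univ fun x _ => hint x y]
  refine Finset.sum_congr rfl fun y _ => ?_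
  rw [intervalIntegral.integral_finsetSum fun x _ => hint x y]
  refine Finset.sum_congr rfl fun x _ => ?_
  rw [intervalIntegral.integral_const_mul, integral_lcPass hQ0 hQY]

lemma sum_sum_mul_integral_lcPValue [Fintype Y] (hQ0 : ∀ z, 0 ≤ Q z) (hQY : ∀ y, 0 < margY Q y)
    (A : X × Y → ℝ) :
    ∑ y, ∑ x, Q (x, y) * ∫ τ in (0 : ℝ)..1, lcPValue Q A x y τ
      = ∫ ε in (0 : ℝ)..1, ∑ y, (1 - ε) * margY Q y := by
  rw [← integral_sum_mul_lcPass hQ0 hQY A fun x y => Q (x, y)]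
  refine intervalIntegral.integral_congr fun ε hε => ?_
  rw [Set.uIcc_of_le zero_le_one] at hε
  exact Finset.sum_congr rfl fun y _ => sum_mul_lcPass hQ0 hQY A hε.1 hε.2 y

lemma lcOFOpt_iff_lcSOpt [Fintype Y] [DecidableEq Y] (hQ0 : ∀ z, 0 ≤ Q z) (hQY : ∀ y, 0 < margY Q y)
    (A : X × Y → ℝ) : lcOFOpt Q A ↔ lcSOpt Q A := by
  have h : ∀ B : X × Y → ℝ, _ := fun B =>
    expZT_sum_erase Q (lcPValue Q B) (intervalIntegrable_lcPValue Q B)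
  simp only [lcOFOpt, lcSOpt, h, sum_sum_mul_integral_lcPValue hQ0 hQY, sub_le_sub_iff_right]

lemma lcOEOpt_iff_lcNOpt [Fintype Y] [DecidableEq Y] (hQ0 : ∀ z, 0 ≤ Q z) (hQY : ∀ y, 0 < margY Q y)
    (A : X × Y → ℝ) : lcOEOpt Q A ↔ lcNOpt Q A := by
  unfold lcOEOpt lcNOpt
  refine forall_congr' fun B => forall₂_congr fun ε hε => ?_
  simp only [expZT_card_lcPredSet_erase, sum_mul_lcPass hQ0 hQY _ hε.1.le hε.2.le,
    sub_le_sub_iff_right]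

lemma lcNOpt.lcSOpt [Fintype Y] (hQ0 : ∀ z, 0 ≤ Q z) (hQY : ∀ y, 0 < margY Q y) {A : X × Y → ℝ}
    (h : lcNOpt Q A) : lcSOpt Q A := by
  intro B
  have hint : ∀ C : X × Y → ℝ, IntervalIntegrable
      (fun ε => ∑ y, ∑ x, margX Q x * lcPass Q C ε x y) volume 0 1 := fun C => by
    simpa only [Finset.sum_fn] using IntervalIntegrable.sum Finset.univ fun y _ =>
      IntervalIntegrable.sum Finset.univ fun x _ =>
        (intervalIntegrable_lcPass Q C x y).const_mul (margX Q x)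
  rw [expXT_sum Q (lcPValue Q A) (intervalIntegrable_lcPValue Q A),
    expXT_sum Q (lcPValue Q B) (intervalIntegrable_lcPValue Q B),
    ← integral_sum_mul_lcPass hQ0 hQY A fun x _ => margX Q x,
    ← integral_sum_mul_lcPass hQ0 hQY B fun x _ => margX Q x]
  refine intervalIntegral.integral_mono_on_of_le_Ioo zero_le_one (hint A) (hint B) fun ε hε => ?_
  simpa only [expXT_card_lcPredSet] using h B ε hε

lemma lcRefines.lcNOpt [Fintype Y] (hQ0 : ∀ z, 0 ≤ Q z) (hQX : ∀ x, 0 < margX Q x)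
    (hQY : ∀ y, 0 < margY Q y) {A : X × Y → ℝ} (h : lcRefines A (condQ Q)) : lcNOpt Q A := by
  intro B ε hε
  rw [expXT_card_lcPredSet, expXT_card_lcPredSet]
  refine Finset.sum_le_sum fun y _ => ?_
  have hvalid : ∀ C, ∑ x, Q (x, y) * lcPass Q C ε x y = (1 - ε) * margY Q y :=
    fun C => sum_mul_lcPass hQ0 hQY C hε.1.le hε.2.le y
  refine neyman_pearson (q := fun x => Q (x, y)) (fun x => hQ0 _) hQX
    (fun x => lcPass_nonneg ..) (fun x => lcPass_nonneg ..) (fun x => lcPass_le_one ..)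
    (fun x x' hlt hpos => lcPass_eq_one_of_lt hQ0 hQY A (h x x' y hlt) hpos) ?_ ?_ ?_
  · rw [hvalid, hvalid]
  · rw [hvalid]
    exact mul_pos (by linarith [hε.2]) (hQY y)
  · rw [hvalid]
    change _ < margY Q y
    nlinarith [hQY y, hε.1]

lemma integral_lcPValue (Q A : X × Y → ℝ) (x : X) (y : Y) :
    ∫ τ in (0 : ℝ)..1, lcPValue Q A x y τ
      = ∑ x', Q (x', y) * halfOrder (A (x', y)) (A (x, y)) / margY Q y := by
  simp only [lcPValue, intervalIntegral.integral_div]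
  rw [intervalIntegral.integral_add (by simp) (Continuous.intervalIntegrable (by fun_prop) _ _),
    intervalIntegral.integral_mul_const, integral_id, ← Finset.sum_div]
  congr 1
  simp only [intervalIntegral.integral_const, Finset.mul_sum, smul_eq_mul,
    ← Finset.sum_add_distrib]
  refine Finset.sum_congr rfl fun x' _ => ?_
  unfold halfOrder
  grind

lemma two_mul_expXT_sum_lcPValue [Fintype Y] (Q A : X × Y → ℝ) :
    2 * expXT Q (fun x τ => ∑ y, lcPValue Q A x y τ)
      = ∑ y, ∑ x, ∑ x', pairCost Q A x x' y / margY Q y := by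
  rw [expXT_sum Q (lcPValue Q A) (intervalIntegrable_lcPValue Q A), Finset.mul_sum]
  refine Finset.sum_congr rfl fun y _ => ?_
  simp only [integral_lcPValue, pairCost, add_div, Finset.sum_add_distrib]
  rw [Finset.sum_comm (f := fun x x' =>
    margX Q x' * Q (x, y) * halfOrder (A (x, y)) (A (x', y)) / margY Q y), two_mul]
  congr 1 <;>
  · refine Finset.sum_congr rfl fun x _ => ?_
    rw [Finset.mul_sum]
    exact Finset.sum_congr rfl fun x' _ => by ring

lemma lcSOpt.lcRefines [Fintype Y] (hQX : ∀ x, 0 < margX Q x) (hQY : ∀ y, 0 < margY Q y)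
    {A : X × Y → ℝ} (h : lcSOpt Q A) : lcRefines A (condQ Q) := by
  intro x₁ x₂ y₀ hlt
  by_contra hA
  have hle : ∀ y x x', pairCost Q (condQ Q) x x' y / margY Q y
      ≤ pairCost Q A x x' y / margY Q y := fun y x x' =>
    div_le_div_of_nonneg_right (pairCost_condQ_le hQX A x x' y) (hQY y).le
  have hstrict : ∑ y, ∑ x, ∑ x', pairCost Q (condQ Q) x x' y / margY Q y
      < ∑ y, ∑ x, ∑ x', pairCost Q A x x' y / margY Q y := by
    refine Finset.sum_lt_sum (fun y _ => Finset.sum_le_sum fun x _ =>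
      Finset.sum_le_sum fun x' _ => hle y x x') ⟨y₀, Finset.mem_univ _, ?_⟩
    refine Finset.sum_lt_sum (fun x _ => Finset.sum_le_sum fun x' _ => hle y₀ x x')
      ⟨x₁, Finset.mem_univ _, ?_⟩
    refine Finset.sum_lt_sum (fun x' _ => hle y₀ x₁ x') ⟨x₂, Finset.mem_univ _, ?_⟩
    exact div_lt_div_of_pos_right (pairCost_condQ_lt hQX hlt (not_lt.mp hA)) (hQY y₀)
  rw [← two_mul_expXT_sum_lcPValue, ← two_mul_expXT_sum_lcPValue] at hstrict
  linarith [h (condQ Q)]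

end LabelConditionalOptimality

/-- **Theorem 5 (Vovk et al.):** `O_lc(S) = O_lc(OF) = O_lc(N) = O_lc(OE) = R_lc(CP)`. -/
theorem stmt18 {X Y : Type*} [Fintype X] [Fintype Y] [DecidableEq Y] [Nonempty X]
    (hY : 2 ≤ Fintype.card Y) (Q : X × Y → ℝ) (hQ0 : ∀ z, 0 ≤ Q z)
    (hQ1 : ∑ z : X × Y, Q z = 1) (hQX : ∀ x, 0 < margX Q x)
    (hQY : ∀ y, 0 < margY Q y) (A : X × Y → ℝ) :
    (lcSOpt Q A ↔ lcOFOpt Q A) ∧ (lcOFOpt Q A ↔ lcNOpt Q A) ∧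
      (lcNOpt Q A ↔ lcOEOpt Q A) ∧ (lcOEOpt Q A ↔ lcRefines A (condQ Q)) := by
  have hSR : lcSOpt Q A → lcRefines A (condQ Q) := lcSOpt.lcRefines hQX hQY
  have hRN : lcRefines A (condQ Q) → lcNOpt Q A := lcRefines.lcNOpt hQ0 hQX hQY
  have hNS : lcNOpt Q A → lcSOpt Q A := lcNOpt.lcSOpt hQ0 hQY
  rw [lcOFOpt_iff_lcSOpt hQ0 hQY, lcOEOpt_iff_lcNOpt hQ0 hQY]
  exact ⟨Iff.rfl, ⟨fun h => hRN (hSR h), hNS⟩, Iff.rfl, ⟨fun h => hSR (hNS h), hRN⟩⟩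
end
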